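/- Every tight chiral rotation pair covers an atomic chiral rotation pair whose type (r, s) satisfies one of the following: {r, s} = {2m, m^α} as an ordered pair in either order, for some odd prime m and some α ≥ 2; or {r, s} = {8, 2^β} in either order, for some β ≥ 5; or (r, s) = (2^α, 2^{α+1}) or (2^{α+1}, 2^α) for some α ≥ 4. -/

import Mathlib

/-- A rotation pair of type `(p, q)`: the group is generated by `a` and `b`,
`a` has order `p`, `b` has order `q`, `p, q ≥ 2`, `(a*b)^2 = 1`, and the cyclic
subgroups generated by `a` and `b` intersect trivially. -/
def IsRotPair {G : Type*} [Group G] (a b : G) (p q : ℕ) : Prop :=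
  Subgroup.closure ({a, b} : Set G) = ⊤ ∧ orderOf a = p ∧ orderOf b = q ∧
    2 ≤ p ∧ 2 ≤ q ∧ (a * b) ^ 2 = 1 ∧
    Subgroup.zpowers a ⊓ Subgroup.zpowers b = ⊥

/-- Tightness: every element is `a ^ i * b ^ j` for some integers `i, j`. -/
def IsTight {G : Type*} [Group G] (a b : G) : Prop :=
  ∀ g : G, ∃ i j : ℤ, g = a ^ i * b ^ j

/-- Orientably regular: some group automorphism inverts both generators. -/
def IsOrientablyRegular {G : Type*} [Group G] (a b : G) : Prop :=
  ∃ φ : G ≃* G, φ a = a⁻¹ ∧ φ b = b⁻¹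

/-- Chiral: no group automorphism inverts both generators. -/
def IsChiral {G : Type*} [Group G] (a b : G) : Prop :=
  ¬ IsOrientablyRegular a b

/-- `(G, a, b)` covers `(H, a', b')` if a homomorphism sends `a ↦ a'`, `b ↦ b'`. -/
def Covers {G H : Type*} [Group G] [Group H] (a b : G) (a' b' : H) : Prop :=
  ∃ f : G →* H, f a = a' ∧ f b = b'

/-- An atomic chiral rotation pair of type `(p, q)`: a tight chiral rotation pair
covering no tight chiral rotation pair of type `(p', q)` with `p' < p` nor one of
type `(p, q')` with `q' < q`. -/
def IsAtomicPair {G : Type*} [Group G] (a b : G) (p q : ℕ) : Prop :=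
  IsRotPair a b p q ∧ IsTight a b ∧ IsChiral a b ∧
  (∀ (H : Type) (instH : Group H) (_ : Finite H) (a' b' : H) (p' : ℕ), p' < p →
      @IsRotPair H instH a' b' p' q → @IsTight H instH a' b' → @IsChiral H instH a' b' →
      ¬ @Covers G H _ instH a b a' b') ∧
  (∀ (H : Type) (instH : Group H) (_ : Finite H) (a' b' : H) (q' : ℕ), q' < q →
      @IsRotPair H instH a' b' p q' → @IsTight H instH a' b' → @IsChiral H instH a' b' →
      ¬ @Covers G H _ instH a b a' b')


def ReflQ {G : Type*} [Group G] (a b : G) (K : Subgroup G) [K.Normal] : Prop :=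
  ∃ f : G →* G ⧸ K, f a = (a : G ⧸ K)⁻¹ ∧ f b = (b : G ⧸ K)⁻¹

structure MinCh {G : Type*} [Group G] (a b : G) : Prop where
  gen : Subgroup.closure ({a, b} : Set G) = ⊤
  inv : (a * b) ^ 2 = 1
  tight : IsTight a b
  disj : Subgroup.zpowers a ⊓ Subgroup.zpowers b = ⊥
  chir : IsChiral a b
  quot : ∀ (K : Subgroup G) [K.Normal], K ≠ ⊥ →
    (K ≤ Subgroup.zpowers a ∨ K ≤ Subgroup.zpowers b) → ReflQ a b K

section basics
variable {G : Type*} [Group G] {a b : G}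

theorem regular_of_hom [Finite G] (hgen : Subgroup.closure ({a, b} : Set G) = ⊤)
    (f : G →* G) (ha : f a = a⁻¹) (hb : f b = b⁻¹) : IsOrientablyRegular a b := by
  have hs : Function.Surjective f := by
    rw [← MonoidHom.range_eq_top, eq_top_iff, ← hgen, Subgroup.closure_le]
    rintro x (rfl | rfl)
    · exact ⟨x⁻¹, by rw [map_inv, ha, inv_inv]⟩
    · exact ⟨x⁻¹, by rw [map_inv, hb, inv_inv]⟩
  have hbij : Function.Bijective f := ⟨Finite.injective_iff_surjective.mpr hs, hs⟩
  exact ⟨MulEquiv.ofBijective f hbij, ha, hb⟩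

theorem regular_of_two [Finite G] (hgen : Subgroup.closure ({a, b} : Set G) = ⊤)
    (K L : Subgroup G) [K.Normal] [L.Normal] (hKL : K ⊓ L = ⊥)
    (hK : ReflQ a b K) (hL : ReflQ a b L) : IsOrientablyRegular a b := by
  obtain ⟨f, fa, fb⟩ := hK
  obtain ⟨g, ga, gb⟩ := hL
  let ι : G →* (G ⧸ K) × (G ⧸ L) := (QuotientGroup.mk' K).prod (QuotientGroup.mk' L)
  have hι : Function.Injective ι := by
    rw [injective_iff_map_eq_one]
    intro x hx
    have h1 : (QuotientGroup.mk' K) x = 1 := congrArg Prod.fst hx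
    have h2 : (QuotientGroup.mk' L) x = 1 := congrArg Prod.snd hx
    have : x ∈ K ⊓ L := ⟨(QuotientGroup.eq_one_iff x).mp h1, (QuotientGroup.eq_one_iff x).mp h2⟩
    rw [hKL] at this
    exact Subgroup.mem_bot.mp this
  let F : G →* (G ⧸ K) × (G ⧸ L) := f.prod g
  have hF : ∀ x, F x ∈ ι.range := by
    intro x
    have : (⊤ : Subgroup G) ≤ ι.range.comap F := by
      rw [← hgen, Subgroup.closure_le]
      rintro x (rfl | rfl)
      · exact ⟨x⁻¹, Prod.ext (by simp [ι, F, fa]) (by simp [ι, F, ga])⟩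
      · exact ⟨x⁻¹, Prod.ext (by simp [ι, F, fb]) (by simp [ι, F, gb])⟩
    exact this (Subgroup.mem_top x)
  let e : G ≃* ι.range := MonoidHom.ofInjective hι
  let φ : G →* G := e.symm.toMonoidHom.comp (F.codRestrict ι.range hF)
  have key : ∀ x y, F x = ι y → φ x = y := by
    intro x y h
    change e.symm _ = y
    rw [MulEquiv.symm_apply_eq]
    exact Subtype.ext h
  refine regular_of_hom hgen φ (key _ _ ?_) (key _ _ ?_)
  · exact Prod.ext (by simp [ι, F, fa]) (by simp [ι, F, ga])
  · exact Prod.ext (by simp [ι, F, fb]) (by simp [ι, F, gb])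

theorem reflQ_of_comm (K : Subgroup G) [K.Normal]
    (h : ∀ x y : G ⧸ K, x * y = y * x) : ReflQ a b K := by
  refine ⟨{ toFun := fun g => ((g : G ⧸ K))⁻¹, map_one' := by simp, map_mul' := ?_ }, rfl, rfl⟩
  intro x y
  rw [QuotientGroup.mk_mul, mul_inv_rev, h]

theorem reflQ_commutator : ReflQ a b (commutator G) := by
  apply reflQ_of_comm
  intro x y
  exact mul_comm (G := Abelianization G) x y

theorem regular_of_comm [Finite G] (hgen : Subgroup.closure ({a, b} : Set G) = ⊤)
    (h : ∀ x y : G, x * y = y * x) : IsOrientablyRegular a b := by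
  refine regular_of_hom hgen { toFun := fun g => g⁻¹, map_one' := by simp, map_mul' := ?_ } rfl rfl
  intro x y
  rw [mul_inv_rev, h]

theorem zpowers_comm_of_gen {x : G} (h : ∀ y : G, y ∈ Subgroup.zpowers x) (u v : G) :
    u * v = v * u := by
  obtain ⟨i, rfl⟩ := h u
  obtain ⟨j, rfl⟩ := h v
  exact ((Commute.refl x).zpow_zpow i j).eq

theorem card_eq [Finite G] (ht : IsTight a b)
    (hd : Subgroup.zpowers a ⊓ Subgroup.zpowers b = ⊥) :
    Nat.card G = orderOf a * orderOf b := by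
  have h : Function.Bijective
      (fun x : Subgroup.zpowers a × Subgroup.zpowers b => (x.1 : G) * (x.2 : G)) := by
    constructor
    · exact Subgroup.mul_injective_of_disjoint (disjoint_iff.mpr hd)
    · intro g
      obtain ⟨i, j, rfl⟩ := ht g
      exact ⟨(⟨a ^ i, i, rfl⟩, ⟨b ^ j, j, rfl⟩), rfl⟩
  rw [← Nat.card_eq_of_bijective _ h, Nat.card_prod, Nat.card_zpowers, Nat.card_zpowers]

theorem swap_inv (h : (a * b) ^ 2 = 1) : (b * a) ^ 2 = 1 := by
  have : (b * a) ^ 2 = a⁻¹ * (a * b) ^ 2 * a := by rw [pow_two, pow_two]; group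
  rw [this, h]; group

theorem swap_tight (h : IsTight a b) : IsTight b a := by
  intro g
  obtain ⟨i, j, hg⟩ := h g⁻¹
  exact ⟨-j, -i, by rw [← inv_inv g, hg]; group⟩

theorem swap_chiral (h : IsChiral a b) : IsChiral b a := fun ⟨φ, h1, h2⟩ => h ⟨φ, h2, h1⟩

theorem MinCh.swap (h : MinCh a b) : MinCh b a where
  gen := by rw [Set.pair_comm]; exact h.gen
  inv := swap_inv h.inv
  tight := swap_tight h.tight
  disj := by rw [inf_comm]; exact h.disj
  chir := swap_chiral h.chir
  quot := fun K _ hK h' => by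
    obtain ⟨f, h1, h2⟩ := h.quot K hK h'.symm
    exact ⟨f, h2, h1⟩

end basics

section nt

/-- geometric sum -/
def gs (x i : ℕ) : ℕ := ∑ j ∈ Finset.range i, x ^ j

theorem gs_zero (x : ℕ) : gs x 0 = 0 := by simp [gs]

theorem gs_succ (x i : ℕ) : gs x (i + 1) = 1 + x * gs x i := by
  unfold gs
  rw [Finset.sum_range_succ', Finset.mul_sum, add_comm]
  simp [pow_succ, mul_comm]

theorem gs_add (x i j : ℕ) : gs x (i + j) = gs x i + x ^ i * gs x j := by
  unfold gs
  rw [Finset.sum_range_add, Finset.mul_sum]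
  simp [pow_add]

theorem gs_mul (x i j : ℕ) : gs x (i * j) = gs x i * gs (x ^ i) j := by
  induction j with
  | zero => simp [gs_zero]
  | succ j ih => rw [mul_add, mul_one, add_comm, gs_add, ih, gs_succ]; ring

theorem gs_modEq {d x : ℕ} (h : x ≡ 1 [MOD d]) (i : ℕ) : gs x i ≡ i [MOD d] := by
  induction i with
  | zero => simp [gs_zero]; rfl
  | succ i ih =>
    rw [gs_succ, add_comm i 1]
    exact Nat.ModEq.add_left 1 (by simpa using h.mul ih)

theorem gs_two_mul (k i : ℕ) : gs k (2 * i) = (1 + k) * gs (k ^ 2) i := by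
  rw [gs_mul]; congr 1; simp [gs_succ, gs_zero]

theorem gs_prime_pow {m k : ℕ} (h : k ≡ 1 [MOD m]) (e : ℕ) : m ^ e ∣ gs k (m ^ e) := by
  induction e with
  | zero => simp
  | succ e ih =>
    rw [pow_succ, gs_mul]
    apply mul_dvd_mul ih
    have h1 : k ^ (m ^ e) ≡ 1 [MOD m] := by simpa using h.pow (m ^ e)
    have := gs_modEq h1 m
    exact (Nat.modEq_zero_iff_dvd.mp (this.trans (by simp [Nat.ModEq])))

/-- geometric sums over multiples of `m`. -/
theorem gs_mul_dvd {m μ K j d : ℕ} (hK : 1 ≤ K) (hm : m ∣ K - 1) (hμ : μ ∣ m * (K - 1))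
    (hd : d ∣ μ) (hj : d ∣ j) : d ∣ gs K (m * j) := by
  rw [gs_mul]
  have h1 : K ^ m ≡ 1 [MOD μ] := by
    have hz : (μ : ℤ) ∣ (m : ℤ) * ((K : ℤ) - 1) := by
      have := Int.natCast_dvd_natCast.mpr hμ
      push_cast [Nat.cast_sub hK] at this
      exact this
    have hmz : (m : ℤ) ∣ (K : ℤ) - 1 := by
      have := Int.natCast_dvd_natCast.mpr hm
      push_cast [Nat.cast_sub hK] at this
      exact this
    have hg : (m : ℤ) ∣ (gs K m : ℤ) := by
      have h0 : K ≡ 1 [MOD m] := ((Nat.modEq_iff_dvd' hK).mpr hm).symm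
      have := gs_modEq h0 m
      exact Int.natCast_dvd_natCast.mpr
        (Nat.modEq_zero_iff_dvd.mp (this.trans (by simp [Nat.ModEq])))
    have hpow : (gs K m : ℤ) * ((K : ℤ) - 1) = (K : ℤ) ^ m - 1 := by
      unfold gs; push_cast; exact geom_sum_mul _ _
    have : (μ : ℤ) ∣ (K : ℤ) ^ m - 1 := by
      rw [← hpow]
      exact hz.trans (mul_dvd_mul_right hg _)
    refine (Nat.modEq_iff_dvd.mpr ?_).symm
    push_cast
    exact this
  have h2 : gs (K ^ m) j ≡ j [MOD d] := gs_modEq (h1.of_dvd hd) j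
  exact Dvd.dvd.mul_left (Nat.modEq_zero_iff_dvd.mp (h2.trans (Nat.modEq_zero_iff_dvd.mpr hj))) _

theorem nt_main {m o Q n p q μ k : ℕ} (hm : m.Prime) (hμ : μ = o * Q) (hQ : 0 < Q)
    (hq : q = 2 * Q) (hlcm : Nat.lcm 2 n = 2 * Q) (hp : p = n * o) (hk : 1 ≤ k)
    (hok : o ∣ k - 1) (hmo : m ∣ o) (hom : ∃ e, o = m ^ e)
    (c2 : ¬ μ ∣ k ^ 2 - 1) (c3 : μ ∣ m * (k ^ 2 - 1))
    (c5 : ∀ i, μ ∣ (k - 1) * gs (k ^ 2) i → Q ∣ i)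
    (c6 : ∀ j, μ ∣ gs k j → ∃ e, p ∣ j * m ^ e) :
    (∃ α : ℕ, m.Prime ∧ Odd m ∧ 2 ≤ α ∧ p = m ^ α ∧ q = 2 * m) ∨
    (∃ β : ℕ, 5 ≤ β ∧ p = 2 ^ β ∧ q = 8) ∨
    (∃ α : ℕ, 4 ≤ α ∧ p = 2 ^ (α + 1) ∧ q = 2 ^ α) := by
  have hK1 : 1 ≤ k ^ 2 := Nat.one_le_pow _ _ hk
  have hfac : k ^ 2 - 1 = (k - 1) * (k + 1) := by
    obtain ⟨r, rfl⟩ : ∃ r, k = r + 1 := ⟨k - 1, by omega⟩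
    simp only [Nat.add_sub_cancel]
    have : (r + 1) ^ 2 = r * (r + 1 + 1) + 1 := by ring
    omega
  have hmk1 : m ∣ k - 1 := hmo.trans hok
  have hmK : m ∣ k ^ 2 - 1 := by rw [hfac]; exact Dvd.dvd.mul_right hmk1 _
  have hk1m : k ≡ 1 [MOD m] := ((Nat.modEq_iff_dvd' hk).mpr hmk1).symm
  have hnQ : Q ∣ n := by
    have : Nat.lcm 2 n ∣ 2 * n := Nat.lcm_dvd (dvd_mul_right _ _) (dvd_mul_left _ _)
    rw [hlcm] at this
    exact Nat.dvd_of_mul_dvd_mul_left (by norm_num) this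
  have hQ1 : Q ≠ 1 := by
    rintro rfl
    apply c2
    rw [hμ, mul_one, hfac]
    exact Dvd.dvd.mul_right hok _
  obtain ⟨e, he⟩ := hom
  have he0 : e ≠ 0 := by
    rintro rfl
    rw [he, pow_zero] at hmo
    exact hm.one_lt.ne' (Nat.dvd_one.mp hmo)
  have ho0 : 0 < o := by rw [he]; exact Nat.pow_pos hm.pos
  -- step 1
  have step1 : ∀ l, l.Prime → l ∣ Q → l = m := by
    intro l hl hlQ
    by_contra hne
    have hcop : Nat.Coprime l m := (Nat.coprime_primes hl hm).mpr hne
    obtain ⟨w, Q', hQ', hQw⟩ := Nat.exists_eq_pow_mul_and_not_dvd hQ.ne' l hl.ne_one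
    have hw : w ≠ 0 := by
      rintro rfl
      rw [pow_zero, one_mul] at hQw
      exact hQ' (hQw ▸ hlQ)
    have hμw : μ = l ^ w * (o * Q') := by rw [hμ, hQw]; ring
    have hlμ' : ¬ l ∣ o * Q' := by
      rw [hl.dvd_mul]
      rintro (h | h)
      · rw [he] at h
        exact hne ((Nat.prime_dvd_prime_iff_eq hl hm).mp (hl.dvd_of_dvd_pow h))
      · exact hQ' h
    have hlm : ¬ l ∣ m := fun h => hne ((Nat.prime_dvd_prime_iff_eq hl hm).mp h)
    have hlK : l ^ w ∣ (k - 1) * (k + 1) := by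
      rw [← hfac]
      have : l ^ w ∣ m * (k ^ 2 - 1) := (Dvd.intro _ hμw.symm).trans c3
      exact (Nat.Coprime.pow_left w hcop).dvd_of_dvd_mul_left this
    have hgs : ∀ r, r ≤ w → l ^ r * (o * Q') ∣ gs (k ^ 2) (m * (l ^ r * (o * Q'))) := by
      intro r hr
      refine gs_mul_dvd hK1 hmK c3 ?_ dvd_rfl
      rw [hμw]
      exact mul_dvd_mul_right (pow_dvd_pow _ hr) _
    rcases hl.eq_two_or_odd' with h2 | hodd
    · subst h2
      have hkodd : 2 ∣ k - 1 := by
        have : 2 ∣ (k - 1) * (k + 1) := (dvd_pow_self 2 hw).trans hlK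
        rcases (Nat.prime_two.dvd_mul).mp this with h | h <;> omega
      obtain ⟨r, rfl⟩ : ∃ r, w = r + 1 := ⟨w - 1, by omega⟩
      have h3 := c5 (m * (2 ^ r * (o * Q'))) (by
        rw [hμw, pow_succ']
        rw [mul_assoc]
        exact mul_dvd_mul hkodd (hgs r (by omega)))
      have h4 : 2 ^ (r + 1) ∣ m * (2 ^ r * (o * Q')) := (Dvd.intro _ hQw.symm).trans h3
      have h5 : 2 ^ r * 2 ∣ 2 ^ r * (m * (o * Q')) := by
        rw [← pow_succ]; convert h4 using 1; ring
      have h6 := Nat.dvd_of_mul_dvd_mul_left (Nat.pow_pos (by norm_num)) h5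
      rcases hl.dvd_mul.mp h6 with h | h
      · exact hlm h
      · exact hlμ' h
    · have h2l : ¬ l ∣ 2 := fun h => by
        have := (Nat.prime_dvd_prime_iff_eq hl Nat.prime_two).mp h
        subst this
        exact absurd hodd (by decide)
      have hg0 := hgs 0 (by omega)
      simp only [pow_zero, one_mul] at hg0
      have hor : l ^ w ∣ k - 1 ∨ l ^ w ∣ k + 1 := by
        by_cases h : l ∣ k - 1
        · left
          have h' : ¬ l ∣ k + 1 := by
            intro h'
            apply h2l
            have := (Nat.dvd_sub h' h)
            have e2 : k + 1 - (k - 1) = 2 := by omega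
            rwa [e2] at this
          exact (Nat.Coprime.pow_left w ((hl.coprime_iff_not_dvd).mpr h')).dvd_of_dvd_mul_right hlK
        · right
          exact (Nat.Coprime.pow_left w ((hl.coprime_iff_not_dvd).mpr h)).dvd_of_dvd_mul_left hlK
      rcases hor with h | h
      · have h3 := c5 (m * (o * Q')) (by rw [hμw]; exact mul_dvd_mul h hg0)
        rcases hl.dvd_mul.mp (hlQ.trans h3) with h | h
        · exact hlm h
        · exact hlμ' h
      · obtain ⟨f, hf⟩ := c6 (2 * (m * (o * Q'))) (by
          rw [gs_two_mul, hμw, add_comm 1 k]; exact mul_dvd_mul h hg0)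
        have h4 : l ∣ 2 * (m * (o * Q')) * m ^ f :=
          (hlQ.trans hnQ).trans ((hp ▸ dvd_mul_right n o : n ∣ p).trans hf)
        rcases hl.dvd_mul.mp h4 with h | h
        · rcases hl.dvd_mul.mp h with h | h
          · exact h2l h
          · rcases hl.dvd_mul.mp h with h | h
            · exact hlm h
            · exact hlμ' h
        · exact hlm (hl.dvd_of_dvd_pow h)
  obtain ⟨v, hv⟩ : ∃ v, Q = m ^ v :=
    ⟨_, Nat.eq_prime_pow_of_unique_prime_dvd hQ.ne' (fun {d} hd h => step1 d hd h)⟩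
  have hv0 : v ≠ 0 := by rintro rfl; exact hQ1 (by simpa using hv)
  have hμE : μ = m ^ (e + v) := by rw [hμ, he, hv, pow_add]
  rcases hm.eq_two_or_odd' with h2 | hodd
  · subst h2
    right
    have hkodd : 2 ∣ k - 1 := hmk1
    -- n
    have hn : n = 2 ^ (v + 1) := by
      have hl2 : Nat.lcm 2 n = 2 ^ (v + 1) := by rw [hlcm, hv, pow_succ']
      obtain ⟨x, hx, rfl⟩ := (Nat.dvd_prime_pow Nat.prime_two).mp (hl2 ▸ Nat.dvd_lcm_right 2 n)
      by_cases hx0 : x = 0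
      · subst hx0
        simp at hl2
        exfalso
        have : 2 ^ (v + 1) = 2 ^ 1 := by rw [← hl2]; norm_num
        have := Nat.pow_right_injective (le_refl 2) this
        omega
      · have : 2 ∣ 2 ^ x := dvd_pow_self 2 hx0
        rwa [Nat.lcm_eq_right this] at hl2
    have hqv : q = 2 ^ (v + 1) := by rw [hq, hv, pow_succ']
    have hpv : p = 2 ^ (v + 1 + e) := by rw [hp, hn, he, ← pow_add]
    have h8 : 8 ∣ k ^ 2 - 1 := by
      rw [hfac]
      obtain ⟨r, hr⟩ := hkodd
      have : k = 2 * r + 1 := by omega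
      subst this
      rcases Nat.even_or_odd' r with ⟨s, rfl | rfl⟩
      · exact ⟨s * (2 * s + 1), by simp only [Nat.add_sub_cancel]; ring⟩
      · exact ⟨(2 * s + 1) * (s + 1), by simp only [Nat.add_sub_cancel]; ring⟩
    have hE4 : 4 ≤ e + v := by
      by_contra hlt
      apply c2
      rw [hμE]
      exact (pow_dvd_pow 2 (by omega : e + v ≤ 3)).trans h8
    by_cases hk4 : 4 ∣ k - 1
    · left
      have hE : 2 ^ (e + v) ∣ 4 * (k - 1) := by
        rw [hμE, hfac] at c3
        obtain ⟨r, hr⟩ := hk4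
        have hcop : Nat.Coprime (2 ^ (e + v)) (2 * r + 1) := by
          apply Nat.Coprime.pow_left
          rw [Nat.coprime_two_left]; exact ⟨r, rfl⟩
        apply hcop.dvd_of_dvd_mul_right
        convert c3 using 1
        have : k + 1 = 2 * (2 * r + 1) := by omega
        rw [this]; ring
      have hg4 : 4 ∣ gs (k ^ 2) 4 := by
        have : k ^ 2 ≡ 1 [MOD 4] :=
          ((Nat.modEq_iff_dvd' hK1).mpr ((by norm_num : 4 ∣ 8).trans h8)).symm
        exact Nat.modEq_zero_iff_dvd.mp ((gs_modEq this 4).trans (by decide))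
      have hQ4 := c5 4 (by
        rw [hμE]
        refine hE.trans ?_
        rw [mul_comm]
        exact mul_dvd_mul_left _ hg4)
      have hv2 : v ≤ 2 := by
        rw [hv] at hQ4
        exact (Nat.pow_dvd_pow_iff_le_right (by norm_num : 1 < 2)).mp
          (by simpa using hQ4 : 2 ^ v ∣ 2 ^ 2)
      have hv2' : 2 ≤ v := by
        by_contra hlt
        apply c2
        have hv1 : v = 1 := by omega
        rw [hμE, hv1, pow_succ, hfac, ← he]
        exact mul_dvd_mul hok (by omega)
      have hv3 : v = 2 := by omega
      subst hv3
      exact ⟨2 + 1 + e, by omega, hpv, by rw [hqv]; norm_num⟩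
    · right
      have he1 : e = 1 := by
        by_contra hne
        apply hk4
        refine dvd_trans ?_ hok
        rw [he]
        exact pow_dvd_pow 2 (by omega : 2 ≤ e)
      subst he1
      exact ⟨v + 1, by omega, hpv, hqv⟩
  · left
    obtain ⟨f, hf⟩ := c6 (m ^ (e + v)) (by rw [hμE]; exact gs_prime_pow hk1m _)
    have hnodd : Odd n := by
      have h1 : n ∣ m ^ (e + v) * m ^ f := (hp ▸ dvd_mul_right n o : n ∣ p).trans hf
      exact Odd.of_dvd_nat ((hodd.pow).mul hodd.pow) h1
    have hn : n = Q := by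
      have : Nat.lcm 2 n = 2 * n :=
        Nat.Coprime.lcm_eq_mul ((Nat.coprime_two_left).mpr hnodd)
      omega
    have hE : m ^ (e + v) ∣ m * (k - 1) := by
      rw [hμE, hfac] at c3
      have hcop : Nat.Coprime m (k + 1) := by
        rw [hm.coprime_iff_not_dvd]
        intro h'
        have := (Nat.dvd_sub h' hmk1)
        have e2 : k + 1 - (k - 1) = 2 := by omega
        rw [e2] at this
        have := (Nat.prime_dvd_prime_iff_eq hm Nat.prime_two).mp this
        subst this
        exact absurd hodd (by decide)
      apply (Nat.Coprime.pow_left (e + v) hcop).dvd_of_dvd_mul_right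
      convert c3 using 1; ring
    have hgm : m ∣ gs (k ^ 2) m := by
      have : k ^ 2 ≡ 1 [MOD m] := by simpa using hk1m.pow 2
      exact Nat.modEq_zero_iff_dvd.mp ((gs_modEq this m).trans (by simp [Nat.ModEq]))
    have hQm : Q ∣ m := c5 m (by
      rw [hμE]
      refine hE.trans ?_
      rw [mul_comm]
      exact mul_dvd_mul_left _ hgm)
    have hQm' : Q = m := ((Nat.dvd_prime hm).mp hQm).resolve_left hQ1
    refine ⟨e + 1, hm, hodd, by omega, ?_, by rw [hq, hQm']⟩
    rw [hp, hn, hQm', he, pow_succ, mul_comm]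

end nt

section lin
open Polynomial

theorem nilp_pow_finrank {F V : Type*} [Field F] [AddCommGroup V] [Module F V]
    [Module.Finite F V] (φ : Module.End F V) (h : IsNilpotent φ) :
    φ ^ Module.finrank F V = 0 := by
  have h1 := LinearMap.aeval_self_charpoly φ
  rw [h.charpoly_eq_X_pow_finrank] at h1
  simpa using h1

theorem end_sub_one_pow {l : ℕ} [Fact l.Prime] {V : Type*} [AddCommGroup V] [Module (ZMod l) V]
    (Z : Module.End (ZMod l) V) (r : ℕ) : (Z - 1) ^ (l ^ r) = Z ^ (l ^ r) - 1 := by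
  have h : ((X : (ZMod l)[X]) - 1) ^ (l ^ r) = X ^ (l ^ r) - 1 := by
    rw [sub_pow_char_pow]; simp
  have := congrArg (aeval Z) h
  simpa using this

theorem end_geom {l : ℕ} [Fact l.Prime] {V : Type*} [AddCommGroup V] [Module (ZMod l) V]
    (Z : Module.End (ZMod l) V) (r : ℕ) :
    ∑ j ∈ Finset.range (l ^ r), Z ^ j = (Z - 1) ^ (l ^ r - 1) := by
  have hl : 0 < l ^ r := Nat.pow_pos (Fact.out : l.Prime).pos
  have h : ∑ j ∈ Finset.range (l ^ r), (X : (ZMod l)[X]) ^ j = (X - 1) ^ (l ^ r - 1) := by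
    have hne : (X : (ZMod l)[X]) - 1 ≠ 0 := by
      have := X_sub_C_ne_zero (1 : ZMod l)
      simpa using this
    apply mul_right_cancel₀ hne
    rw [geom_sum_mul, ← pow_succ, Nat.sub_add_cancel hl, sub_pow_char_pow]; simp
  have := congrArg (aeval Z) h
  simpa [map_sum] using this

theorem vdim {l : ℕ} [hl : Fact l.Prime] {V : Type*} [AddCommGroup V] [Finite V]
    [Module (ZMod l) V] (Y : Module.End (ZMod l) V) (c : V) (N : ℕ) (hN : 0 < N)
    (hYN : Y ^ N = 1)
    (hs : ∀ v : V, ∃ i : ℕ, v = ∑ j ∈ Finset.range i, ((Y ^ 2) ^ j) c) :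
    Nat.card V ≤ l := by
  set Z := Y ^ 2 with hZ
  let s : ℕ → V := fun i => ∑ j ∈ Finset.range i, (Z ^ j) c
  have s_add : ∀ i j, s (i + j) = s i + (Z ^ i) (s j) := by
    intro i j
    simp only [s, Finset.sum_range_add, map_sum]
    congr 1
    apply Finset.sum_congr rfl
    intro x _
    rw [pow_add]; rfl
  have hZN : Z ^ N = 1 := by rw [hZ, ← pow_mul, mul_comm, pow_mul, hYN, one_pow]
  have per : ∀ r, 0 < r → s r = 0 → Nat.card V ≤ r := by
    intro r hr h0
    have hmul : ∀ j, s (r * j) = 0 := by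
      intro j
      induction j with
      | zero => simp [s]
      | succ j ih => rw [mul_add, mul_one, s_add, ih, h0, map_zero, add_zero]
    have hsurj : Function.Surjective (fun i : Fin r => s i) := by
      intro v
      obtain ⟨i, hi⟩ := hs v
      refine ⟨⟨i % r, Nat.mod_lt _ hr⟩, ?_⟩
      have : s i = s (i % r) := by
        conv_lhs => rw [← Nat.mod_add_div i r]
        rw [s_add, hmul, map_zero, add_zero]
      rw [hi]; exact this.symm
    have := Nat.card_le_card_of_surjective _ hsurj
    simpa using this
  have hex : ∃ r, 0 < r ∧ s r = 0 := by
    refine ⟨N * l, Nat.mul_pos hN hl.out.pos, ?_⟩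
    have : ∀ j, s (N * j) = j • s N := by
      intro j
      induction j with
      | zero => simp [s]
      | succ j ih =>
        rw [mul_add, mul_one, s_add, ih, pow_mul, hZN, one_pow, succ_nsmul]; rfl
    rw [this]
    have := (ZMod.natCast_self l)
    rw [← Nat.cast_smul_eq_nsmul (ZMod l), this, zero_smul]
  classical
  obtain ⟨hr0, hrs⟩ := Nat.find_spec hex
  have hmin := fun {x} => Nat.find_min (m := x) hex
  set r0 := Nat.find hex with hr0def
  have hZinj : ∀ i v, (Z ^ i) v = 0 → v = 0 := by
    intro i v hv
    have h1 : (Z ^ (N * i)) v = v := by rw [pow_mul, hZN, one_pow]; rfl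
    have h2 : i ≤ N * i := Nat.le_mul_of_pos_left _ hN
    rw [← h1, ← Nat.sub_add_cancel h2, pow_add]
    change (Z ^ (N * i - i)) ((Z ^ i) v) = 0
    rw [hv, map_zero]
  have hcard : Nat.card V = r0 := by
    apply le_antisymm (per r0 hr0 hrs)
    have hinj : Function.Injective (fun i : Fin r0 => s i) := by
      have key : ∀ i j : ℕ, i < j → j < r0 → s i ≠ s j := by
        intro i j hij hj heq
        obtain ⟨d, rfl⟩ := Nat.exists_eq_add_of_lt hij
        rw [add_assoc, s_add] at heq
        have h0 := hZinj i _ (by simpa using heq.symm : (Z ^ i) (s (d + 1)) = 0)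
        exact hmin (x := d + 1) (by omega) ⟨by omega, h0⟩
      intro i j hij
      rcases lt_trichotomy (i : ℕ) j with h | h | h
      · exact absurd hij (key _ _ h j.2)
      · exact Fin.ext h
      · exact absurd hij.symm (key _ _ h i.2)
    have := Nat.card_le_card_of_injective _ hinj
    simpa using this
  have hfin : Module.Finite (ZMod l) V := Module.Finite.of_finite
  have hw : Nat.card V = l ^ Module.finrank (ZMod l) V := by
    rw [Module.natCard_eq_pow_finrank (K := ZMod l), Nat.card_zmod]
  set w := Module.finrank (ZMod l) V with hwdef
  -- Z ^ (l^w) = 1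
  have hZw : Z ^ (l ^ w) = 1 := by
    have hc : (Z ^ (l ^ w)) c = c := by
      have h1 : s (l ^ w + 1) = s (l ^ w) + (Z ^ (l ^ w)) (s 1) := s_add _ _
      have h2 : s (1 + l ^ w) = s 1 + (Z ^ 1) (s (l ^ w)) := s_add _ _
      have h3 : s 1 = c := by simp [s]
      have h4 : s (l ^ w) = 0 := by rw [← hw, hcard]; exact hrs
      rw [h4, h3] at h1 h2
      rw [add_comm, h2] at h1
      simpa using h1.symm
    ext v
    obtain ⟨i, hi⟩ := hs v
    rw [hi, map_sum]
    change _ = ∑ j ∈ Finset.range i, (Z ^ j) c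
    apply Finset.sum_congr rfl
    intro j _
    change (Z ^ (l ^ w) * Z ^ j) c = _
    rw [← pow_add, add_comm, pow_add]
    change (Z ^ j) ((Z ^ (l ^ w)) c) = _
    rw [hc]
  have hnil : (Z - 1) ^ (l ^ w) = 0 := by rw [end_sub_one_pow, hZw, sub_self]
  have hnw : (Z - 1) ^ w = 0 := nilp_pow_finrank _ ⟨_, hnil⟩
  by_contra hlt
  have hw2 : 2 ≤ w := by
    by_contra h
    apply hlt
    rw [hw]
    calc l ^ w ≤ l ^ 1 := Nat.pow_le_pow_right hl.out.pos (by omega)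
      _ = l := pow_one l
  have hs0 : ∀ r, s (l ^ r) = ((Z - 1) ^ (l ^ r - 1)) c := by
    intro r
    rw [← end_geom]
    simp [s, LinearMap.sum_apply]
  have hcontra : s (l ^ (w - 1)) = 0 → False := by
    intro h
    have h1 := per _ (Nat.pow_pos hl.out.pos) h
    rw [hw] at h1
    have := (Nat.pow_le_pow_iff_right hl.out.one_lt).mp h1
    omega
  by_cases hsp : l = 2 ∧ w = 2
  · obtain ⟨rfl, hw'⟩ := hsp
    have hY : (Y - 1) ^ 2 = Z - 1 := by
      have := end_sub_one_pow Y 1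
      simpa using this
    have hYn : (Y - 1) ^ w = 0 := nilp_pow_finrank _ ⟨2 * 2 ^ w, by rw [pow_mul, hY, hnil]⟩
    apply hcontra
    rw [hs0, hw']
    rw [hw', hY] at hYn
    simp [hYn]
  · apply hcontra
    rw [hs0]
    have hle : w ≤ l ^ (w - 1) - 1 := by
      have h2 := hl.out.two_le
      suffices H : ∀ w : ℕ, 2 ≤ w → ¬ (l = 2 ∧ w = 2) → w ≤ l ^ (w - 1) - 1 from H w hw2 hsp
      clear * - h2
      intro w hw2 hsp
      obtain ⟨u, rfl⟩ : ∃ u, w = u + 2 := ⟨w - 2, by omega⟩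
      have e1 : u + 2 - 1 = u + 1 := by omega
      rw [e1]
      by_cases h3 : l = 2
      · have hu : 1 ≤ u := by omega
        have h4 : ∀ x : ℕ, x + 1 + 3 ≤ 2 ^ (x + 1 + 1) := by
          intro x
          induction x with
          | zero => norm_num
          | succ x ih => rw [pow_succ 2 (x + 1 + 1)]; omega
        have := h4 (u - 1)
        rw [Nat.sub_add_cancel hu] at this
        rw [h3]; omega
      · have h4 : ∀ x : ℕ, x + 3 ≤ 3 ^ (x + 1) := by
          intro x
          induction x with
          | zero => norm_num
          | succ x ih => rw [pow_succ]; omega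
        have := h4 u
        have h5 : 3 ^ (u + 1) ≤ l ^ (u + 1) := Nat.pow_le_pow_left (by omega) _
        omega
    rw [← Nat.sub_add_cancel hle, pow_add, hnw, mul_zero]
    rfl

theorem vdim1 {l : ℕ} [hl : Fact l.Prime] {V : Type*} [AddCommGroup V] [Finite V]
    [Module (ZMod l) V] (Y : Module.End (ZMod l) V) (y : V →+ V) (hYy : ∀ x, Y x = y x)
    (c : V) (N : ℕ) (hN : 0 < N)
    (hyN : ∀ x, (⇑y)^[N] x = x)
    (hs : ∀ v : V, ∃ i : ℕ, v = ∑ j ∈ Finset.range i, (⇑y)^[2 * j] c) :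
    Nat.card V ≤ l := by
  have hY : ∀ (i : ℕ) (x : V), (Y ^ i) x = (⇑y)^[i] x := by
    intro i x
    have : ⇑Y = ⇑y := funext hYy
    rw [Module.End.pow_apply, this]
  refine vdim Y c N hN ?_ ?_
  · ext v
    rw [hY, hyN]; rfl
  · intro v
    obtain ⟨i, hi⟩ := hs v
    refine ⟨i, hi.trans (Finset.sum_congr rfl fun j _ => ?_)⟩
    rw [← pow_mul, hY]

theorem vdim' {l : ℕ} (hl : l.Prime) {V : Type*} [AddCommGroup V] [Finite V]
    (hlV : ∀ v : V, l • v = 0) (y : V →+ V) (c : V) (N : ℕ) (hN : 0 < N)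
    (hyN : ∀ x, (⇑y)^[N] x = x)
    (hs : ∀ v : V, ∃ i : ℕ, v = ∑ j ∈ Finset.range i, (⇑y)^[2 * j] c) :
    Nat.card V ≤ l := by
  let _ : Module (ZMod l) V := AddCommGroup.zmodModule hlV
  have : Fact l.Prime := ⟨hl⟩
  exact vdim1 (l := l) (y.toZModLinearMap l) y (fun _ => rfl) c N hN hyN hs

theorem cyclic_of_cover {M : Type*} [AddCommGroup M] [Finite M] (y : M →+ M) (c : M)
    (N : ℕ) (hN : 0 < N) (hyN : ∀ x, (⇑y)^[N] x = x)
    (hgen : ∀ L : AddSubgroup M, (∀ x ∈ L, y x ∈ L) → c ∈ L → L = ⊤)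
    (hcov : ∀ l : ℕ, l.Prime →
      (∀ x : M, ∃ (i : ℕ) (w : M), x = (∑ j ∈ Finset.range i, (⇑y)^[2 * j] c) + l • w) ∨
      (∃ d : M, ∀ x : M, ∃ (j : ℤ) (w : M), x = j • d + l • w)) :
    ∀ x : M, x ∈ AddSubgroup.zmultiples c := by
  have key : ∀ l : ℕ, l.Prime → ∀ x : M, ∃ (j : ℤ) (w : M), x = j • c + l • w := by
    intro l hl
    let R : AddSubgroup M := (nsmulAddMonoidHom l : M →+ M).range
    have hRy : R ≤ R.comap y := by
      rintro _ ⟨w, rfl⟩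
      exact ⟨y w, by simp⟩
    have hlV : ∀ v : M ⧸ R, l • v = 0 := by
      intro v
      obtain ⟨x, rfl⟩ := QuotientAddGroup.mk_surjective v
      rw [← QuotientAddGroup.mk_nsmul]
      exact (QuotientAddGroup.eq_zero_iff _).mpr ⟨x, rfl⟩
    let y' : (M ⧸ R) →+ (M ⧸ R) := QuotientAddGroup.map R R y hRy
    have hYmk : ∀ (i : ℕ) (x : M), (⇑y')^[i] (QuotientAddGroup.mk x : M ⧸ R) =
        QuotientAddGroup.mk ((⇑y)^[i] x) := by
      intro i
      induction i with
      | zero => intro x; rfl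
      | succ i ih =>
        intro x
        rw [Function.iterate_succ_apply, Function.iterate_succ_apply, ← ih]
        rfl
    have hcard : Nat.card (M ⧸ R) ≤ l := by
      rcases hcov l hl with h | ⟨d, h⟩
      · refine vdim' hl hlV y' (c : M ⧸ R) N hN ?_ ?_
        · intro v
          obtain ⟨x, rfl⟩ := QuotientAddGroup.mk_surjective v
          rw [hYmk, hyN]
        · intro v
          obtain ⟨x, rfl⟩ := QuotientAddGroup.mk_surjective v
          obtain ⟨i, w, hx⟩ := h x
          refine ⟨i, ?_⟩
          conv_lhs => rw [hx]
          rw [QuotientAddGroup.mk_add, (QuotientAddGroup.eq_zero_iff (N := R) (l • w)).mpr (⟨w, rfl⟩ : l • w ∈ R), add_zero]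
          rw [← QuotientAddGroup.mk'_apply, map_sum]
          apply Finset.sum_congr rfl
          intro j _
          rw [hYmk]; rfl
      · have hs : Function.Surjective
            (fun z : AddSubgroup.zmultiples (d : M ⧸ R) => (z : M ⧸ R)) := by
          intro v
          obtain ⟨x, rfl⟩ := QuotientAddGroup.mk_surjective v
          obtain ⟨j, w, hx⟩ := h x
          refine ⟨⟨j • (d : M ⧸ R), j, rfl⟩, ?_⟩
          conv_rhs => rw [hx]
          rw [QuotientAddGroup.mk_add, (QuotientAddGroup.eq_zero_iff (N := R) (l • w)).mpr (⟨w, rfl⟩ : l • w ∈ R), add_zero]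
          rfl
        refine (Nat.card_le_card_of_surjective _ hs).trans ?_
        rw [Nat.card_zmultiples]
        exact Nat.le_of_dvd hl.pos (addOrderOf_dvd_of_nsmul_eq_zero (hlV _))
    by_cases hc : (c : M ⧸ R) = 0
    · have hcR : c ∈ R := (QuotientAddGroup.eq_zero_iff c).mp hc
      have hR := hgen R (fun x hx => hRy hx) hcR
      intro x
      obtain ⟨w, hw⟩ : x ∈ R := hR ▸ AddSubgroup.mem_top x
      exact ⟨0, w, by simpa using hw.symm⟩
    · have ho : addOrderOf (c : M ⧸ R) = l := by
        rcases (Nat.dvd_prime hl).mp (addOrderOf_dvd_of_nsmul_eq_zero (hlV (c : M ⧸ R))) with h | h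
        · exact absurd (AddMonoid.addOrderOf_eq_one_iff.mp h) hc
        · exact h
      have htop : AddSubgroup.zmultiples (c : M ⧸ R) = ⊤ := by
        apply AddSubgroup.eq_top_of_le_card
        rw [Nat.card_zmultiples, ho]; exact hcard
      intro x
      obtain ⟨j, hj⟩ : (x : M ⧸ R) ∈ AddSubgroup.zmultiples (c : M ⧸ R) :=
        htop ▸ AddSubgroup.mem_top _
      have hj' : ((j • c : M) : M ⧸ R) = (x : M ⧸ R) := hj
      obtain ⟨w, hw⟩ := QuotientAddGroup.eq.mp hj'
      refine ⟨j, w, ?_⟩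
      have hw' : l • w = -(j • c) + x := hw
      rw [hw']; abel
  by_contra hne
  have hC : AddSubgroup.zmultiples c ≠ ⊤ := fun h => hne fun x => h ▸ AddSubgroup.mem_top x
  let C := AddSubgroup.zmultiples c
  have hcard : Nat.card (M ⧸ C) ≠ 1 := fun h => hC (AddSubgroup.index_eq_one.mp h)
  obtain ⟨l, hl, hdiv⟩ := Nat.exists_prime_and_dvd hcard
  have : Fact l.Prime := ⟨hl⟩
  obtain ⟨v, hv⟩ := exists_prime_addOrderOf_dvd_card' l hdiv
  have hsurj : Function.Surjective (fun u : M ⧸ C => l • u) := by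
    intro u
    obtain ⟨x, rfl⟩ := QuotientAddGroup.mk_surjective u
    obtain ⟨j, w, hx⟩ := key l hl x
    refine ⟨(w : M ⧸ C), ?_⟩
    conv_rhs => rw [hx]
    rw [QuotientAddGroup.mk_add, (QuotientAddGroup.eq_zero_iff (N := C) (j • c)).mpr (⟨j, rfl⟩ : j • c ∈ C), zero_add]
    rfl
  have hinj := Finite.injective_iff_surjective.mpr hsurj
  have hv0 : v = 0 := hinj (by
    change l • v = l • 0
    rw [smul_zero, ← hv]; exact addOrderOf_nsmul_eq_zero v)
  rw [hv0, addOrderOf_zero] at hv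
  exact hl.one_lt.ne hv

end lin

section str
variable {G : Type*} [Group G] {a b t : G}

/-- A subgroup modulo which the two generators commute contains the commutator subgroup. -/
theorem commutator_le_of_gen {x y : G} (hgen : Subgroup.closure ({x, y} : Set G) = ⊤)
    (K : Subgroup G) [K.Normal] (h : (x : G ⧸ K) * (y : G ⧸ K) = (y : G ⧸ K) * (x : G ⧸ K)) :
    commutator G ≤ K := by
  have h1 : IsMulCommutative (Subgroup.closure ({(x : G ⧸ K), (y : G ⧸ K)} : Set (G ⧸ K))) := by
    apply Subgroup.isMulCommutative_closure
    rintro u (rfl | rfl) v (rfl | rfl)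
    · rfl
    · exact h
    · exact h.symm
    · rfl
  have h2 : ∀ g : G, (g : G ⧸ K) ∈
      Subgroup.closure ({(x : G ⧸ K), (y : G ⧸ K)} : Set (G ⧸ K)) := by
    intro g
    have : (⊤ : Subgroup G) ≤ (Subgroup.closure
        ({(x : G ⧸ K), (y : G ⧸ K)} : Set (G ⧸ K))).comap (QuotientGroup.mk' K) := by
      rw [← hgen, Subgroup.closure_le]
      rintro u (rfl | rfl)
      · exact Subgroup.subset_closure (by simp)
      · exact Subgroup.subset_closure (by simp)
    exact this (Subgroup.mem_top g)
  rw [commutator_def, Subgroup.commutator_le]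
  intro u _ v _
  rw [← QuotientGroup.eq_one_iff, commutatorElement_def]
  have h3 : (u : G ⧸ K) * (v : G ⧸ K) = (v : G ⧸ K) * (u : G ⧸ K) :=
    congrArg Subtype.val (h1.is_comm.comm ⟨_, h2 u⟩ ⟨_, h2 v⟩)
  rw [QuotientGroup.mk_mul, QuotientGroup.mk_mul, QuotientGroup.mk_mul, h3]
  simp

theorem normal_of_gen [Finite G] {x y : G} (hgen : Subgroup.closure ({x, y} : Set G) = ⊤)
    (L : Subgroup G) (hx : ∀ g ∈ L, x * g * x⁻¹ ∈ L) (hy : ∀ g ∈ L, y * g * y⁻¹ ∈ L) :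
    L.Normal := by
  rw [← Subgroup.normalizer_eq_top_iff, eq_top_iff, ← hgen, Subgroup.closure_le]
  rintro u (rfl | rfl)
  · exact Subgroup.mem_normalizer_fintype hx
  · exact Subgroup.mem_normalizer_fintype hy

/-- Ito's theorem for a product of two cyclic groups. -/
theorem ito (hgen : Subgroup.closure ({a, b} : Set G) = ⊤) (ht : IsTight a b) [Finite G] :
    ∀ x ∈ commutator G, ∀ y ∈ commutator G, x * y = y * x := by
  have ht' := swap_tight ht
  let cm : G → G → G := fun x y => x⁻¹ * y⁻¹ * x * y
  have hca : ∀ i j : ℤ, a ^ i * a ^ j = a ^ j * a ^ i :=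
    fun i j => ((Commute.refl a).zpow_zpow i j).eq
  have hcb : ∀ i j : ℤ, b ^ i * b ^ j = b ^ j * b ^ i :=
    fun i j => ((Commute.refl b).zpow_zpow i j).eq
  have cj : ∀ x y g : G, g⁻¹ * cm x y * g = cm (g⁻¹ * x * g) (g⁻¹ * y * g) := by
    intro x y g; simp only [cm]; group
  have c1 : ∀ x y z : G, x * y = y * x → cm x (y * z) = cm x z := by
    intro x y z h
    have : x⁻¹ * (y * z)⁻¹ * x = x⁻¹ * z⁻¹ * (y⁻¹ * x) := by group
    simp only [cm]
    rw [this]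
    have h' : y⁻¹ * x = x * y⁻¹ := by
      rw [inv_mul_eq_iff_eq_mul, ← mul_assoc, ← h, mul_inv_cancel_right]
    rw [h']; group
  have c2 : ∀ x y z : G, y * x = x * y → cm (y * z) x = cm z x := by
    intro x y z h
    have h' : y⁻¹ * x⁻¹ * y = x⁻¹ := by
      have h3 : x⁻¹ * y = y * x⁻¹ := by
        rw [inv_mul_eq_iff_eq_mul, ← mul_assoc, ← h, mul_inv_cancel_right]
      rw [mul_assoc, h3, inv_mul_cancel_left]
    have : (y * z)⁻¹ * x⁻¹ * (y * z) * x = z⁻¹ * (y⁻¹ * x⁻¹ * y) * z * x := by group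
    simp only [cm]
    rw [this, h']
  have fixa : ∀ g i : ℤ, (a ^ g)⁻¹ * a ^ i * a ^ g = a ^ i := by
    intro g i; rw [mul_assoc, hca i g]; group
  have fixb : ∀ g i : ℤ, (b ^ g)⁻¹ * b ^ i * b ^ g = b ^ i := by
    intro g i; rw [mul_assoc, hcb i g]; group
  have ea : ∀ j g : ℤ, ∃ j' : ℤ, ∀ i : ℤ,
      (a ^ g)⁻¹ * cm (a ^ i) (b ^ j) * a ^ g = cm (a ^ i) (b ^ j') := by
    intro j g
    obtain ⟨i2, j2, h⟩ := ht ((a ^ g)⁻¹ * b ^ j * a ^ g)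
    refine ⟨j2, fun i => ?_⟩
    rw [cj, fixa, h, c1 _ _ _ (hca _ _)]
  have eb : ∀ i g : ℤ, ∃ i' : ℤ, ∀ j : ℤ,
      (b ^ g)⁻¹ * cm (a ^ i) (b ^ j) * b ^ g = cm (a ^ i') (b ^ j) := by
    intro i g
    obtain ⟨j3, i3, h⟩ := ht' ((b ^ g)⁻¹ * a ^ i * b ^ g)
    refine ⟨i3, fun j => ?_⟩
    rw [cj, fixb, h, c2 _ _ _ (hcb _ _)]
  let S : Set G := {x | ∃ i j : ℤ, x = cm (a ^ i) (b ^ j)}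
  have hcomm : ∀ x ∈ S, ∀ y ∈ S, x * y = y * x := by
    rintro _ ⟨i, j, rfl⟩ _ ⟨g, h, rfl⟩
    obtain ⟨j', hj'⟩ := ea j (-g)
    obtain ⟨i', hi'⟩ := eb i (-h)
    have e1 : (b ^ (-h))⁻¹ * ((a ^ (-g))⁻¹ * cm (a ^ i) (b ^ j) * a ^ (-g)) * b ^ (-h)
        = cm (a ^ i') (b ^ j') := by
      rw [hj' i, hi' j']
    have e2 : (a ^ (-g))⁻¹ * ((b ^ (-h))⁻¹ * cm (a ^ i) (b ^ j) * b ^ (-h)) * a ^ (-g)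
        = cm (a ^ i') (b ^ j') := by
      rw [hi' j, hj' i']
    have e3 := e1.trans e2.symm
    rw [zpow_neg, zpow_neg] at e3
    generalize cm (a ^ i) (b ^ j) = x at e3
    change x * ((a ^ g)⁻¹ * (b ^ h)⁻¹ * a ^ g * b ^ h) = ((a ^ g)⁻¹ * (b ^ h)⁻¹ * a ^ g * b ^ h) * x
    generalize a ^ g = u at *
    generalize b ^ h = v at *
    calc _ = u⁻¹ * v⁻¹ * (v⁻¹⁻¹ * (u⁻¹⁻¹ * x * u⁻¹) * v⁻¹) * u * v := by group
      _ = _ := by rw [e3]; group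
  have hSa : ∀ g ∈ Subgroup.closure S, a * g * a⁻¹ ∈ Subgroup.closure S := by
    have : Subgroup.closure S ≤ (Subgroup.closure S).comap (MulAut.conj a).toMonoidHom := by
      rw [Subgroup.closure_le]
      rintro _ ⟨i, j, rfl⟩
      obtain ⟨j', hj'⟩ := ea j (-1)
      have := hj' i
      rw [zpow_neg, zpow_one, inv_inv] at this
      exact Subgroup.subset_closure ⟨i, j', this⟩
    exact fun g hg => this hg
  have hSb : ∀ g ∈ Subgroup.closure S, b * g * b⁻¹ ∈ Subgroup.closure S := by
    have : Subgroup.closure S ≤ (Subgroup.closure S).comap (MulAut.conj b).toMonoidHom := by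
      rw [Subgroup.closure_le]
      rintro _ ⟨i, j, rfl⟩
      obtain ⟨i', hi'⟩ := eb i (-1)
      have := hi' j
      rw [zpow_neg, zpow_one, inv_inv] at this
      exact Subgroup.subset_closure ⟨i', j, this⟩
    exact fun g hg => this hg
  have hN : (Subgroup.closure S).Normal := normal_of_gen hgen _ hSa hSb
  have hle : commutator G ≤ Subgroup.closure S := by
    apply commutator_le_of_gen hgen
    rw [← QuotientGroup.mk_mul, ← QuotientGroup.mk_mul, eq_comm, QuotientGroup.eq]
    refine Subgroup.subset_closure ⟨1, 1, ?_⟩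
    simp only [cm, zpow_one]; group
  have hc := (Subgroup.isMulCommutative_closure hcomm).is_comm
  intro x hx y hy
  exact congrArg Subtype.val (hc.comm ⟨x, hle hx⟩ ⟨y, hle hy⟩)

/-- Basic set-up: generated by `a` and an involution `t`, with abelian commutator subgroup. -/
structure St (a t : G) : Prop where
  gen : Subgroup.closure ({a, t} : Set G) = ⊤
  tt : t * t = 1
  comm : ∀ x ∈ commutator G, ∀ y ∈ commutator G, x * y = y * x

theorem MinCh.st [Finite G] (h : MinCh a b) : St a (a * b) where
  gen := by
    rw [eq_top_iff, ← h.gen, Subgroup.closure_le]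
    have ha : a ∈ Subgroup.closure ({a, a * b} : Set G) := Subgroup.subset_closure (by simp)
    have hb : a * b ∈ Subgroup.closure ({a, a * b} : Set G) := Subgroup.subset_closure (by simp)
    rintro u (rfl | rfl)
    · exact ha
    · have := Subgroup.mul_mem _ (Subgroup.inv_mem _ ha) hb
      simpa using this
  tt := by rw [← pow_two]; exact h.inv
  comm := ito h.gen h.tight

theorem St.tinv (h : St a t) : t⁻¹ = t := inv_eq_of_mul_eq_one_left h.tt

theorem St.ttx (h : St a t) (x : G) : t * (t * x) = x := by rw [← mul_assoc, h.tt, one_mul]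

theorem St.comm_le (h : St a t) (K : Subgroup G) [K.Normal] (hc : t * a * t * a⁻¹ ∈ K) :
    commutator G ≤ K := by
  apply commutator_le_of_gen h.gen
  rw [← QuotientGroup.mk_mul, ← QuotientGroup.mk_mul, QuotientGroup.eq]
  have := Subgroup.Normal.conj_mem (inferInstance : K.Normal) _ (K.inv_mem hc) (a⁻¹ : G)
  have e : (a * t)⁻¹ * (t * a) = a⁻¹ * (t * a * t * a⁻¹)⁻¹ * a⁻¹⁻¹ := by
    simp [h.tinv, mul_assoc]
  rw [e]; exact this

theorem St.c_mem (h : St a t) : t * a * t * a⁻¹ ∈ commutator G := by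
  have := Subgroup.commutator_mem_commutator (Subgroup.mem_top t) (Subgroup.mem_top a)
  rwa [commutatorElement_def, h.tinv, ← commutator_def] at this

theorem St.inv (h : St a t) : ∀ x ∈ commutator G, t * x * t = x⁻¹ := by
  let L : Subgroup G :=
    { carrier := {x | x ∈ commutator G ∧ t * x * t = x⁻¹}
      one_mem' := ⟨one_mem _, by simp [h.tt]⟩
      mul_mem' := by
        rintro x y ⟨hx, hx'⟩ ⟨hy, hy'⟩
        refine ⟨mul_mem hx hy, ?_⟩
        calc t * (x * y) * t = (t * x * (t * t) * y * t) := by rw [h.tt]; group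
          _ = (t * x * t) * (t * y * t) := by group
          _ = _ := by rw [hx', hy', ← mul_inv_rev, h.comm _ hx _ hy]
      inv_mem' := by
        rintro x ⟨hx, hx'⟩
        refine ⟨inv_mem hx, ?_⟩
        have := congrArg (fun z => z⁻¹) hx'
        simpa only [mul_inv_rev, h.tinv, mul_assoc] using this }
  have hL : L.Normal := by
    constructor
    rintro x ⟨hx, hx'⟩ w
    refine ⟨Subgroup.Normal.conj_mem inferInstance _ hx _, ?_⟩
    have hm : t * w * t⁻¹ * w⁻¹ ∈ commutator G := by
      have := Subgroup.commutator_mem_commutator (Subgroup.mem_top t) (Subgroup.mem_top w)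
      rwa [commutatorElement_def, ← commutator_def] at this
    have hy : w * x⁻¹ * w⁻¹ ∈ commutator G :=
      Subgroup.Normal.conj_mem inferInstance _ (inv_mem hx) _
    have e : t * (w * x * w⁻¹) * t =
        (t * w * t⁻¹ * w⁻¹) * (w * (t * x * t) * w⁻¹) * (t * w * t⁻¹ * w⁻¹)⁻¹ := by
      simp [h.tinv, mul_assoc, h.ttx]
    rw [e, hx', h.comm _ hm _ hy]
    group
  have := h.comm_le L ⟨h.c_mem, by simp [mul_assoc, h.ttx, h.tinv]⟩
  exact fun x hx => (this hx).2

/-- `M` is the smallest `a`-stable subgroup containing `c`. -/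
theorem St.min [Finite G] (h : St a t) (L : Subgroup G) (hLM : L ≤ commutator G)
    (ha : ∀ x ∈ L, a * x * a⁻¹ ∈ L) (hc : t * a * t * a⁻¹ ∈ L) : commutator G ≤ L := by
  have : L.Normal := by
    apply normal_of_gen h.gen _ ha
    intro x hx
    rw [h.tinv, h.inv x (hLM hx)]
    exact inv_mem hx
  exact h.comm_le L hc

theorem St.normal_a [Finite G] (h : St a t) (K : Subgroup G) (h1 : K ≤ commutator G)
    (h2 : K ≤ Subgroup.zpowers a) : K.Normal := by
  apply normal_of_gen h.gen
  · intro x hx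
    obtain ⟨i, hi⟩ := h2 hx
    have hi' : a ^ i = x := hi
    have : a * x * a⁻¹ = x := by rw [← hi']; group
    rwa [this]
  · intro x hx
    rw [h.tinv, h.inv x (h1 hx)]
    exact inv_mem hx

theorem St.normal_b [Finite G] (h : St a (a * b)) (K : Subgroup G) (h1 : K ≤ commutator G)
    (h2 : K ≤ Subgroup.zpowers b) : K.Normal := by
  apply normal_of_gen h.gen
  · intro x hx
    obtain ⟨i, hi⟩ := h2 hx
    have hi' : b ^ i = x := hi
    have e : a * x * a⁻¹ = (a * b) * x * (a * b)⁻¹ := by rw [← hi']; group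
    rw [e, h.tinv, h.inv x (h1 hx)]
    exact inv_mem hx
  · intro x hx
    rw [h.tinv, h.inv x (h1 hx)]
    exact inv_mem hx

/-- Since `p ≥ q`, the subgroup generated by `a` has non-trivial core. -/
theorem MinCh.core [Finite G] (h : MinCh a b) (hpq : orderOf b ≤ orderOf a) :
    ∃ K : Subgroup G, K.Normal ∧ K ≠ ⊥ ∧ K ≤ Subgroup.zpowers a := by
  have hs := h.st
  set t := a * b with ht
  let K : Subgroup G := Subgroup.zpowers a ⊓ (Subgroup.zpowers a).comap (MulAut.conj t).toMonoidHom
  have hmem : ∀ x, x ∈ K ↔ x ∈ Subgroup.zpowers a ∧ t * x * t⁻¹ ∈ Subgroup.zpowers a := by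
    intro x; rfl
  refine ⟨K, ?_, ?_, inf_le_left⟩
  · apply normal_of_gen hs.gen
    · intro x hx
      obtain ⟨i, hi⟩ := (inf_le_left : K ≤ _) hx
      have hi' : a ^ i = x := hi
      have : a * x * a⁻¹ = x := by rw [← hi']; group
      rwa [this]
    · intro x hx
      rw [hmem] at *
      refine ⟨hx.2, ?_⟩
      have : t * (t * x * t⁻¹) * t⁻¹ = x := by simp [hs.tinv, mul_assoc, hs.ttx, hs.tt]
      rw [this]; exact hx.1
  · intro hK
    have hinj : Function.Injective
        (fun z : Subgroup.zpowers a × Subgroup.zpowers a => (z.1 : G) * t * (z.2 : G)) := by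
      rintro ⟨⟨x, hx⟩, ⟨y, hy⟩⟩ ⟨⟨x', hx'⟩, ⟨y', hy'⟩⟩ heq
      have heq' : x * t * y = x' * t * y' := heq
      have e1 : t * (y * y'⁻¹) * t⁻¹ = x⁻¹ * x' := by
        have : x⁻¹ * (x * t * y) * y'⁻¹ * t⁻¹ = x⁻¹ * (x' * t * y') * y'⁻¹ * t⁻¹ := by rw [heq']
        calc _ = x⁻¹ * (x * t * y) * y'⁻¹ * t⁻¹ := by group
          _ = _ := by rw [this]; group
      have e2 : y * y'⁻¹ ∈ K := by
        rw [hmem, e1]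
        exact ⟨mul_mem hy (inv_mem hy'), mul_mem (inv_mem hx) hx'⟩
      rw [hK, Subgroup.mem_bot] at e2
      rw [e2, mul_one, mul_inv_cancel] at e1
      have e3 : y = y' := by rwa [mul_inv_eq_one] at e2
      have e4 : x = x' := by
        have := e1.symm
        rwa [inv_mul_eq_one] at this
      subst e3; subst e4; rfl
    have hcard : Nat.card G ≤ Nat.card (Subgroup.zpowers a × Subgroup.zpowers a) := by
      rw [card_eq h.tight h.disj, Nat.card_prod, Nat.card_zpowers]
      exact Nat.mul_le_mul_left _ hpq
    have hbij := (Nat.bijective_iff_injective_and_card _).mpr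
      ⟨hinj, le_antisymm (Nat.card_le_card_of_injective _ hinj) hcard⟩
    obtain ⟨⟨⟨x, hx⟩, ⟨y, hy⟩⟩, hxy⟩ := hbij.2 1
    have hxy' : x * t * y = 1 := hxy
    have htA : t ∈ Subgroup.zpowers a := by
      have : t = x⁻¹ * y⁻¹ := by
        calc t = x⁻¹ * (x * t * y) * y⁻¹ := by group
          _ = _ := by rw [hxy']; group
      rw [this]
      exact mul_mem (inv_mem hx) (inv_mem hy)
    have htop : Subgroup.zpowers a = ⊤ := by
      rw [eq_top_iff, ← hs.gen, Subgroup.closure_le]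
      rintro u (rfl | rfl)
      · exact Subgroup.mem_zpowers _
      · exact htA
    refine h.chir (regular_of_comm h.gen (zpowers_comm_of_gen (x := a) fun y => ?_))
    rw [htop]; trivial

theorem MinCh.meetM [Finite G] (h : MinCh a b) (K : Subgroup G) [K.Normal] (hK : K ≠ ⊥)
    (hle : K ≤ Subgroup.zpowers a ∨ K ≤ Subgroup.zpowers b) : K ⊓ commutator G ≠ ⊥ :=
  fun h0 => h.chir (regular_of_two h.gen K (commutator G) h0 (h.quot K hK hle) reflQ_commutator)

theorem MinCh.AM [Finite G] (h : MinCh a b) (hpq : orderOf b ≤ orderOf a) :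
    Subgroup.zpowers a ⊓ commutator G ≠ ⊥ := by
  obtain ⟨K, hN, hK, hle⟩ := h.core hpq
  intro h0
  apply h.meetM K hK (Or.inl hle)
  rw [eq_bot_iff, ← h0]
  exact inf_le_inf_right _ hle

theorem MinCh.disj_normal [Finite G] (h : MinCh a b) (K L : Subgroup G) [K.Normal] [L.Normal]
    (hK : K ≠ ⊥) (hL : L ≠ ⊥)
    (hKa : K ≤ Subgroup.zpowers a ∨ K ≤ Subgroup.zpowers b)
    (hLa : L ≤ Subgroup.zpowers a ∨ L ≤ Subgroup.zpowers b) : K ⊓ L ≠ ⊥ :=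
  fun h0 => h.chir (regular_of_two h.gen K L h0 (h.quot K hK hKa) (h.quot L hL hLa))

theorem MinCh.B_core [Finite G] (h : MinCh a b) (hpq : orderOf b ≤ orderOf a)
    (L : Subgroup G) [L.Normal] (hL : L ≤ Subgroup.zpowers b) : L = ⊥ := by
  by_contra hne
  obtain ⟨K, hN, hK, hle⟩ := h.core hpq
  apply h.disj_normal K L hK hne (Or.inl hle) (Or.inr hL)
  rw [eq_bot_iff, ← h.disj]
  exact inf_le_inf hle hL

theorem MinCh.BM [Finite G] (h : MinCh a b) (hpq : orderOf b ≤ orderOf a) :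
    Subgroup.zpowers b ⊓ commutator G = ⊥ := by
  have : (Subgroup.zpowers b ⊓ commutator G).Normal :=
    h.st.normal_b _ inf_le_right inf_le_left
  exact h.B_core hpq _ inf_le_left

theorem normal_zpowers_of_central {x y z : G} [Finite G]
    (hgen : Subgroup.closure ({x, y} : Set G) = ⊤)
    (hx : x * z = z * x) (hy : y * z = z * y) : (Subgroup.zpowers z).Normal := by
  apply normal_of_gen hgen
  · rintro _ ⟨i, rfl⟩
    have : x * z ^ i = z ^ i * x := ((show Commute x z from hx).zpow_right i).eq
    refine ⟨i, ?_⟩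
    change z ^ i = x * z ^ i * x⁻¹
    rw [this, mul_inv_cancel_right]
  · rintro _ ⟨i, rfl⟩
    have : y * z ^ i = z ^ i * y := ((show Commute y z from hy).zpow_right i).eq
    refine ⟨i, ?_⟩
    change z ^ i = y * z ^ i * y⁻¹
    rw [this, mul_inv_cancel_right]

theorem MinCh.b_central [Finite G] (h : MinCh a b) (hpq : orderOf b ≤ orderOf a) {x : G}
    (hx : x ∈ Subgroup.zpowers b) (hc : a * x = x * a) : x = 1 := by
  have hb : b * x = x * b := by
    obtain ⟨i, rfl⟩ := hx
    exact ((Commute.refl b).zpow_right i).eq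
  have := normal_zpowers_of_central h.gen hc hb
  have h0 := h.B_core hpq (Subgroup.zpowers x) ((Subgroup.zpowers_le).mpr hx)
  rwa [Subgroup.zpowers_eq_bot] at h0

/-- The unique minimal normal subgroup inside `⟨a⟩`. -/
theorem MinCh.prime [Finite G] (h : MinCh a b) (hpq : orderOf b ≤ orderOf a) :
    ∃ (m : ℕ) (N : Subgroup G), m.Prime ∧ N.Normal ∧ Nat.card N = m ∧
      N ≤ Subgroup.zpowers a ∧ N ≤ commutator G ∧
      ∀ K : Subgroup G, K.Normal → K ≠ ⊥ → K ≤ Subgroup.zpowers a → N ≤ K := by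
  have h1 := h.AM hpq
  have hcard : Nat.card (Subgroup.zpowers a ⊓ commutator G : Subgroup G) ≠ 1 :=
    fun h0 => h1 (Subgroup.card_eq_one.mp h0)
  obtain ⟨m, hm, hdiv⟩ := Nat.exists_prime_and_dvd hcard
  have : Fact m.Prime := ⟨hm⟩
  obtain ⟨⟨z, hz⟩, hzo⟩ := exists_prime_orderOf_dvd_card' m hdiv
  have hzo' : orderOf z = m := by rw [← hzo, Subgroup.orderOf_mk]
  have hle : Subgroup.zpowers z ≤ Subgroup.zpowers a := (Subgroup.zpowers_le).mpr hz.1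
  have hle' : Subgroup.zpowers z ≤ commutator G := (Subgroup.zpowers_le).mpr hz.2
  have hN := h.st.normal_a _ hle' hle
  have hcN : Nat.card (Subgroup.zpowers z) = m := by rw [Nat.card_zpowers, hzo']
  have hne : Subgroup.zpowers z ≠ ⊥ := by
    intro h0
    rw [h0, Subgroup.card_bot] at hcN
    exact hm.one_lt.ne hcN
  refine ⟨m, Subgroup.zpowers z, hm, hN, hcN, hle, hle', ?_⟩
  intro K hK hKb hKa
  have h2 := h.disj_normal _ K hne hKb (Or.inl hle) (Or.inl hKa)
  have h3 : Nat.card (Subgroup.zpowers z ⊓ K : Subgroup G) ∣ Nat.card (Subgroup.zpowers z) :=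
    Subgroup.card_dvd_of_le inf_le_left
  rw [hcN] at h3
  rcases (Nat.dvd_prime hm).mp h3 with h4 | h4
  · exact absurd (Subgroup.card_eq_one.mp h4) h2
  · have : Subgroup.zpowers z ⊓ K = Subgroup.zpowers z :=
      Subgroup.eq_of_le_of_card_ge inf_le_left (by rw [h4, hcN])
    exact inf_eq_left.mp this

theorem m_power [Finite G] {m : ℕ} {N : Subgroup G} (hm : m.Prime) (hcN : Nat.card N = m)
    (hN : ∀ K : Subgroup G, K.Normal → K ≠ ⊥ → K ≤ Subgroup.zpowers a → N ≤ K)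
    {x : G} (hx : x ∈ Subgroup.zpowers a) (hnorm : ∀ i : ℕ, (Subgroup.zpowers (x ^ i)).Normal) :
    ∃ e : ℕ, x ^ (m ^ e) = 1 := by
  obtain ⟨e, u, hu, hou⟩ := Nat.exists_eq_pow_mul_and_not_dvd (orderOf_pos x).ne' m hm.ne_one
  refine ⟨e, ?_⟩
  by_contra hne
  have h1 := hN _ (hnorm (m ^ e)) (by rwa [Ne, Subgroup.zpowers_eq_bot])
    ((Subgroup.zpowers_le).mpr (pow_mem hx _))
  have h2 := Subgroup.card_dvd_of_le h1
  rw [hcN, Nat.card_zpowers] at h2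
  have h3 : orderOf (x ^ m ^ e) ∣ u := by
    apply orderOf_dvd_of_pow_eq_one
    rw [← pow_mul, ← hou, pow_orderOf_eq_one]
  exact hu (h2.trans h3)

theorem tA_notin [Finite G] (h : St a t) (hAM : Subgroup.zpowers a ⊓ commutator G ≠ ⊥) (j : ℤ) :
    t * a ^ j ∉ commutator G := by
  intro hg
  have hconj : ∀ x ∈ commutator G, a * x * a⁻¹ ∈ commutator G :=
    fun x hx => Subgroup.Normal.conj_mem inferInstance _ hx _
  let φ : commutator G →* commutator G :=
    { toFun := fun x => ⟨x * (a * x * a⁻¹)⁻¹, mul_mem x.2 (inv_mem (hconj _ x.2))⟩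
      map_one' := by simp
      map_mul' := by
        rintro ⟨x, hx⟩ ⟨y, hy⟩
        apply Subtype.ext
        change x * y * (a * (x * y) * a⁻¹)⁻¹ = x * (a * x * a⁻¹)⁻¹ * (y * (a * y * a⁻¹)⁻¹)
        have e : (a * (x * y) * a⁻¹)⁻¹ = (a * y * a⁻¹)⁻¹ * (a * x * a⁻¹)⁻¹ := by group
        rw [e, h.comm _ (inv_mem (hconj _ hy)) _ (inv_mem (hconj _ hx)), mul_assoc, mul_assoc x,
          ← mul_assoc y, h.comm _ hy _ (inv_mem (hconj _ hx)), mul_assoc] }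
  have hmap : commutator G ≤ φ.range.map (commutator G).subtype := by
    apply h.min
    · rintro _ ⟨x, _, rfl⟩; exact x.2
    · rintro _ ⟨_, ⟨x, rfl⟩, rfl⟩
      refine ⟨_, ⟨⟨_, hconj _ x.2⟩, rfl⟩, ?_⟩
      change a * x * a⁻¹ * (a * (a * x * a⁻¹) * a⁻¹)⁻¹ = a * (x * (a * x * a⁻¹)⁻¹) * a⁻¹
      group
    · refine ⟨_, ⟨⟨_, hg⟩, rfl⟩, ?_⟩
      change t * a ^ j * (a * (t * a ^ j) * a⁻¹)⁻¹ = t * a * t * a⁻¹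
      calc _ = t * a * t⁻¹ * a⁻¹ := by group
        _ = _ := by rw [h.tinv]
  have hsurj : Function.Surjective φ := by
    rintro ⟨x, hx⟩
    obtain ⟨z, ⟨w, hw⟩, hz⟩ := hmap hx
    exact ⟨w, by rw [hw]; exact Subtype.ext hz⟩
  have hinj := Finite.injective_iff_surjective.mpr hsurj
  apply hAM
  rw [eq_bot_iff]
  rintro x ⟨hx, hxM⟩
  have h1 : φ ⟨x, hxM⟩ = 1 := by
    apply Subtype.ext
    change x * (a * x * a⁻¹)⁻¹ = 1
    obtain ⟨i, hi⟩ := hx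
    have hi' : a ^ i = x := hi
    rw [← hi']; group
  have h2 : (⟨x, hxM⟩ : commutator G) = 1 := hinj (h1.trans (map_one φ).symm)
  exact congrArg Subtype.val h2

end str

section str2
variable {G : Type*} [Group G] {a b t : G}

theorem mem_comm_iff (x : G) : x ∈ commutator G ↔ Abelianization.of x = 1 :=
  (QuotientGroup.eq_one_iff (N := commutator G) x).symm

theorem cg_even {A : Type*} [CommGroup A] (x y : A) (h : x * y * (x * y) = 1) (r v : ℤ) :
    y ^ (r + r) * x ^ v = x ^ (v - (r + r)) := by
  have h2 : (x * y) ^ (r + r) = 1 := by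
    rw [zpow_add, ← mul_zpow, h, one_zpow]
  rw [mul_zpow] at h2
  rw [← inv_eq_of_mul_eq_one_right h2, ← zpow_neg, ← zpow_add]
  congr 1; ring

theorem cg_odd {A : Type*} [CommGroup A] (x y : A) (h : x * y * (x * y) = 1) (r v : ℤ) :
    y ^ (2 * r + 1) * x ^ v = x * y * x ^ (v - (2 * r + 1)) := by
  have h1 := cg_even x y h r (v - 1)
  have e1 : (2 * r + 1 : ℤ) = (r + r) + 1 := by ring
  have e2 : v = 1 + (v - 1) := by ring
  have e3 : v - (r + r + 1) = v - 1 - (r + r) := by ring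
  have e4 : x ^ v = x * x ^ (v - 1) := by rw [← zpow_one_add, ← e2]
  rw [e1, e3, ← h1, zpow_add_one, e4]
  generalize x ^ (v - 1) = z
  generalize y ^ (r + r) = w
  ac_rfl

theorem St.of_tt (h : St a (a * b)) :
    Abelianization.of a * Abelianization.of b * (Abelianization.of a * Abelianization.of b)
      = 1 := by
  rw [← map_mul, ← map_mul, h.tt, map_one]

theorem ba_even (h : St a (a * b)) (u v : ℤ) (hu : Even u) :
    b ^ u * a ^ v ∈ commutator G ↔ a ^ (v - u) ∈ commutator G := by
  rw [mem_comm_iff, mem_comm_iff]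
  obtain ⟨r, rfl⟩ := hu
  rw [map_mul, map_zpow, map_zpow, map_zpow, cg_even _ _ h.of_tt]

theorem ba_odd (h : St a (a * b)) (u v : ℤ) (hu : ¬ Even u) :
    b ^ u * a ^ v ∈ commutator G ↔ (a * b) * a ^ (v - u) ∈ commutator G := by
  rw [mem_comm_iff, mem_comm_iff]
  obtain ⟨r, rfl⟩ := Int.not_even_iff_odd.mp hu
  rw [map_mul, map_zpow, map_zpow, map_mul, map_zpow, map_mul, cg_odd _ _ h.of_tt]

theorem pow_mem_iff (j : ℤ) :
    a ^ j ∈ commutator G ↔ (orderOf (Abelianization.of a) : ℤ) ∣ j := by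
  rw [mem_comm_iff, map_zpow, orderOf_dvd_iff_zpow_eq_one]

theorem MinCh.ba_mem [Finite G] (h : MinCh a b) (hpq : orderOf b ≤ orderOf a) (u v : ℤ) :
    b ^ u * a ^ v ∈ commutator G ↔ Even u ∧ (orderOf (Abelianization.of a) : ℤ) ∣ v - u := by
  by_cases hu : Even u
  · rw [ba_even h.st u v hu, pow_mem_iff]; tauto
  · rw [ba_odd h.st u v hu]
    have := tA_notin h.st (h.AM hpq) (v - u)
    tauto

theorem MinCh.q_eq [Finite G] (h : MinCh a b) (hpq : orderOf b ≤ orderOf a) :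
    orderOf b = Nat.lcm 2 (orderOf (Abelianization.of a)) := by
  have key : ∀ j : ℕ, orderOf b ∣ j ↔ 2 ∣ j ∧ orderOf (Abelianization.of a) ∣ j := by
    intro j
    have h1 := h.ba_mem hpq j 0
    rw [zpow_zero, mul_one, zero_sub, dvd_neg, Int.natCast_dvd_natCast, Int.even_coe_nat,
      even_iff_two_dvd, zpow_natCast] at h1
    rw [← h1, orderOf_dvd_iff_pow_eq_one]
    constructor
    · intro h2; rw [h2]; exact one_mem _
    · intro h2
      have : b ^ j ∈ Subgroup.zpowers b ⊓ commutator G := ⟨pow_mem (Subgroup.mem_zpowers b) j, h2⟩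
      rw [h.BM hpq] at this
      exact this
  apply Nat.dvd_antisymm
  · rw [key]; exact ⟨Nat.dvd_lcm_left _ _, Nat.dvd_lcm_right _ _⟩
  · exact Nat.lcm_dvd ((key _).mp dvd_rfl).1 ((key _).mp dvd_rfl).2

theorem n_pos [Finite G] : 0 < orderOf (Abelianization.of a) := by
  have : Finite (Abelianization G) := inferInstanceAs (Finite (G ⧸ commutator G))
  exact orderOf_pos _

theorem MinCh.card_ab [Finite G] (h : MinCh a b) (hpq : orderOf b ≤ orderOf a) :
    Nat.card (G ⧸ commutator G) = orderOf (Abelianization.of a) * 2 := by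
  have h1 := Subgroup.card_mul_index (Subgroup.zpowers (Abelianization.of a))
  have h2 : (Subgroup.zpowers (Abelianization.of a)).index = 2 := by
    rw [Subgroup.index_eq_two_iff]
    have hout : ∀ v : ℤ, Abelianization.of (a * b) ≠ Abelianization.of a ^ v := by
      intro v hv
      apply tA_notin h.st (h.AM hpq) (-v)
      rw [mem_comm_iff, map_mul, hv, map_zpow, ← zpow_add, add_neg_cancel, zpow_zero]
    have htt : Abelianization.of (a * b) * Abelianization.of (a * b) = 1 := by
      rw [← map_mul, h.st.tt, map_one]
    have hx : ∀ x : Abelianization G, x ∈ Subgroup.zpowers (Abelianization.of a) ∨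
        x * Abelianization.of (a * b) ∈ Subgroup.zpowers (Abelianization.of a) := by
      intro x
      obtain ⟨g, rfl⟩ := QuotientGroup.mk_surjective x
      obtain ⟨u, v, rfl⟩ := swap_tight h.tight g
      change Abelianization.of (b ^ u * a ^ v) ∈ _ ∨ Abelianization.of (b ^ u * a ^ v) * _ ∈ _
      rcases Int.even_or_odd u with ⟨r, rfl⟩ | ⟨r, rfl⟩
      · left
        rw [map_mul, map_zpow, map_zpow, cg_even _ _ h.st.of_tt]
        exact ⟨_, rfl⟩
      · right
        rw [map_mul, map_zpow, map_zpow, cg_odd _ _ h.st.of_tt, ← map_mul, mul_comm, ← mul_assoc,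
          htt, one_mul]
        exact ⟨_, rfl⟩
    refine ⟨Abelianization.of (a * b), fun x => ?_⟩
    have hnot : ¬ (x * Abelianization.of (a * b) ∈ Subgroup.zpowers (Abelianization.of a) ∧
        x ∈ Subgroup.zpowers (Abelianization.of a)) := by
      rintro ⟨h3, h4⟩
      have h5 := mul_mem (inv_mem h4) h3
      rw [inv_mul_cancel_left] at h5
      obtain ⟨v, hv⟩ := h5
      exact hout v hv.symm
    rcases hx x with h3 | h3
    · exact Or.inr ⟨h3, fun h4 => hnot ⟨h4, h3⟩⟩
    · exact Or.inl ⟨h3, fun h4 => hnot ⟨h3, h4⟩⟩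
  rw [h2, Nat.card_zpowers] at h1
  exact h1.symm

theorem n_dvd_p [Finite G] : orderOf (Abelianization.of a) ∣ orderOf a := by
  apply orderOf_dvd_of_pow_eq_one
  rw [← map_pow, pow_orderOf_eq_one, map_one]

theorem p_eq [Finite G] : orderOf a = orderOf (Abelianization.of a) *
    orderOf (a ^ orderOf (Abelianization.of a)) := by
  rw [orderOf_pow_of_dvd n_pos.ne' n_dvd_p, Nat.mul_div_cancel' n_dvd_p]

theorem MinCh.card_M [Finite G] (h : MinCh a b) (hpq : orderOf b ≤ orderOf a) {Q : ℕ}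
    (hQ : orderOf b = 2 * Q) :
    Nat.card (commutator G) = orderOf (a ^ orderOf (Abelianization.of a)) * Q := by
  have h1 := Subgroup.card_mul_index (commutator G)
  have h2 : (commutator G).index = orderOf (Abelianization.of a) * 2 := h.card_ab hpq
  rw [h2, card_eq h.tight h.disj, hQ, p_eq (a := a)] at h1
  have h3 : 0 < orderOf (Abelianization.of a) * 2 := by
    have := n_pos (a := a); omega
  apply Nat.eq_of_mul_eq_mul_right h3
  rw [h1]; ring

/-- Multiplicative form of `cyclic_of_cover`. -/
theorem cyclic_of_cover_mul [Finite G] (M : Subgroup G)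
    (hM : ∀ x ∈ M, ∀ y ∈ M, x * y = y * x) (a c : G) (hay : ∀ x ∈ M, a * x * a⁻¹ ∈ M)
    (hc : c ∈ M)
    (hgen : ∀ L : Subgroup G, L ≤ M → (∀ x ∈ L, a * x * a⁻¹ ∈ L) → c ∈ L → M ≤ L)
    (S : ℕ → G) (hS0 : S 0 = 1) (hS : ∀ i, S (i + 1) = c * (a * (a * S i * a⁻¹) * a⁻¹))
    (hcov : ∀ l : ℕ, l.Prime →
      (∀ x ∈ M, ∃ (i : ℕ), ∃ w ∈ M, x = S i * w ^ l) ∨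
      (∃ d ∈ M, ∀ x ∈ M, ∃ (j : ℤ), ∃ w ∈ M, x = d ^ j * w ^ l)) :
    M ≤ Subgroup.zpowers c := by
  let _ : CommGroup M := { (inferInstance : Group M) with
    mul_comm := fun x y => Subtype.ext (hM x x.2 y y.2) }
  let y0 : M →* M :=
    { toFun := fun x => ⟨a * x * a⁻¹, hay x x.2⟩
      map_one' := by apply Subtype.ext; simp
      map_mul' := by
        rintro ⟨x, hx⟩ ⟨y, hy⟩
        apply Subtype.ext
        change a * (x * y) * a⁻¹ = a * x * a⁻¹ * (a * y * a⁻¹)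
        group }
  let y : Additive M →+ Additive M := MonoidHom.toAdditive y0
  let v : Additive M → G := fun x => ((Additive.toMul x : M) : G)
  have hv : Function.Injective v := fun x y h => Subtype.ext h
  have vadd : ∀ x z, v (x + z) = v x * v z := fun _ _ => rfl
  have vy : ∀ x, v (y x) = a * v x * a⁻¹ := fun _ => rfl
  have vn : ∀ (l : ℕ) x, v (l • x) = v x ^ l := fun _ _ => rfl
  have vz : ∀ (l : ℤ) x, v (l • x) = v x ^ l := fun _ _ => rfl
  have vmk : ∀ g, g ∈ M → ∃ x, v x = g := fun g hg => ⟨Additive.ofMul ⟨g, hg⟩, rfl⟩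
  have vM : ∀ x, v x ∈ M := fun x => (Additive.toMul x).2
  let c' : Additive M := Additive.ofMul ⟨c, hc⟩
  have hvc : v c' = c := rfl
  have vS : ∀ i, v (∑ j ∈ Finset.range i, (⇑y)^[2 * j] c') = S i := by
    intro i
    induction i with
    | zero => rw [hS0]; rfl
    | succ i ih =>
      rw [Finset.sum_range_succ', add_comm, vadd, hS, ← ih]
      congr 1
      rw [← vy, ← vy, map_sum, map_sum]
      congr 1
      apply Finset.sum_congr rfl
      intro j _
      rw [mul_add, mul_one, add_comm, Function.iterate_add_apply]
      rfl
  have main := cyclic_of_cover y c' (orderOf a) (orderOf_pos a) ?_ ?_ ?_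
  · intro x hx
    obtain ⟨x', rfl⟩ := vmk x hx
    obtain ⟨j, hj⟩ := main x'
    exact ⟨j, by rw [← hj]; rfl⟩
  · have : ∀ i x, v ((⇑y)^[i] x) = a ^ i * v x * (a ^ i)⁻¹ := by
      intro i
      induction i with
      | zero => intro x; simp
      | succ i ih =>
        intro x
        rw [Function.iterate_succ_apply, ih, vy, pow_succ]; group
    intro x
    apply hv
    rw [this, pow_orderOf_eq_one]; simp
  · intro L hL hcL
    let L' : Subgroup G :=
      { carrier := {g | ∃ x ∈ L, v x = g}
        one_mem' := ⟨0, zero_mem _, rfl⟩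
        mul_mem' := by
          rintro _ _ ⟨x, hx, rfl⟩ ⟨z, hz, rfl⟩
          exact ⟨x + z, add_mem hx hz, rfl⟩
        inv_mem' := by
          rintro _ ⟨x, hx, rfl⟩
          exact ⟨-x, neg_mem hx, rfl⟩ }
    have := hgen L' (by rintro _ ⟨x, _, rfl⟩; exact vM x)
      (by rintro _ ⟨x, hx, rfl⟩; exact ⟨y x, hL x hx, rfl⟩) ⟨c', hcL, rfl⟩
    rw [eq_top_iff]
    intro x _
    obtain ⟨z, hz, hzx⟩ := this (vM x)
    rwa [← hv hzx]
  · intro l hl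
    rcases hcov l hl with h1 | ⟨d, hd, h1⟩
    · left
      intro x
      obtain ⟨i, w, hw, hx⟩ := h1 (v x) (vM x)
      obtain ⟨w', rfl⟩ := vmk w hw
      exact ⟨i, w', hv (by rw [hx, vadd, vn, vS])⟩
    · right
      obtain ⟨d', rfl⟩ := vmk d hd
      refine ⟨d', fun x => ?_⟩
      obtain ⟨j, w, hw, hx⟩ := h1 (v x) (vM x)
      obtain ⟨w', rfl⟩ := vmk w hw
      exact ⟨j, w', hv (by rw [hx, vadd, vn, vz])⟩

end str2

section str3
variable {G : Type*} [Group G] {a b t : G}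

/-- The elements `b^{-2i} a^{-2i}` of the commutator subgroup. -/
def sqel (a b : G) (i : ℕ) : G := b⁻¹ ^ (2 * i) * a⁻¹ ^ (2 * i)

theorem sqel_zero : sqel a b 0 = 1 := by simp [sqel]

theorem St.binv (h : St a (a * b)) : a * b * a = b⁻¹ := by
  have h1 : (a * b * a) * b = 1 := by rw [mul_assoc]; exact h.tt
  exact eq_inv_of_mul_eq_one_left h1

theorem sqel_succ (h : St a (a * b)) (i : ℕ) : sqel a b (i + 1) =
    ((a * b) * a * (a * b) * a⁻¹) * (a * (a * sqel a b i * a⁻¹) * a⁻¹) := by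
  have e : ((a * b) * a * (a * b) * a⁻¹) * (a * (a * sqel a b i * a⁻¹) * a⁻¹) =
      (a * b * a) * (a * b * a) * sqel a b i * a⁻¹ * a⁻¹ := by group
  rw [e, h.binv, sqel, sqel]
  group

theorem exists_nat_pow [Finite G] (x : G) (u : ℤ) : ∃ v : ℕ, x ^ u = x ^ v := by
  obtain ⟨v, hv⟩ := mem_powers_iff_mem_zpowers.mpr (⟨u, rfl⟩ : x ^ u ∈ Subgroup.zpowers x)
  exact ⟨v, hv.symm⟩

theorem MinCh.decomp [Finite G] (h : MinCh a b) (hpq : orderOf b ≤ orderOf a) {x : G}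
    (hx : x ∈ commutator G) :
    ∃ i j : ℕ, x = sqel a b i * (a ^ orderOf (Abelianization.of a)) ^ j := by
  obtain ⟨u, v, rfl⟩ := swap_tight h.tight x
  obtain ⟨u', hu'⟩ := exists_nat_pow b⁻¹ (-u)
  rw [inv_zpow, zpow_neg, inv_inv] at hu'
  have e1 : b ^ u = b ^ (-(u' : ℤ)) := by rw [hu', zpow_neg, inv_pow, zpow_natCast]
  rw [e1, h.ba_mem hpq] at hx
  obtain ⟨h1, w, hw⟩ := hx
  rw [even_neg, Int.even_coe_nat] at h1
  obtain ⟨i, hi⟩ := h1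
  obtain ⟨j, hj⟩ := exists_nat_pow (a ^ orderOf (Abelianization.of a)) w
  refine ⟨i, j, ?_⟩
  have hv : v = -((2 * i : ℕ) : ℤ) + orderOf (Abelianization.of a) * w := by
    subst hi; push_cast at *; linarith
  rw [hu', ← hj, hv, zpow_add, zpow_mul, zpow_neg, zpow_natCast, zpow_natCast, sqel, inv_pow a, hi,
    ← two_mul, mul_assoc]

theorem MinCh.sqel_add [Finite G] (_h : MinCh a b) {Q : ℕ} (hQ : orderOf b = 2 * Q) (i e : ℕ) :
    sqel a b (i + Q * e) = sqel a b i * a⁻¹ ^ (orderOf b * e) := by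
  have h1 : b⁻¹ ^ (2 * Q) = 1 := by rw [← hQ, ← orderOf_inv, pow_orderOf_eq_one]
  rw [sqel, sqel, mul_add, pow_add, pow_add, ← mul_assoc 2, pow_mul b⁻¹ (2 * Q), h1, one_pow, mul_one,
    hQ, mul_assoc (b⁻¹ ^ (2 * i))]

theorem MinCh.delta_mem [Finite G] (_h : MinCh a b) :
    a ^ orderOf (Abelianization.of a) ∈ commutator G := by
  have := (pow_mem_iff (a := a) (orderOf (Abelianization.of a))).mpr dvd_rfl
  rwa [zpow_natCast] at this

theorem MinCh.cyclic [Finite G] (h : MinCh a b) (hpq : orderOf b ≤ orderOf a) :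
    commutator G ≤ Subgroup.zpowers ((a * b) * a * (a * b) * a⁻¹) := by
  obtain ⟨Q, hQ⟩ : 2 ∣ orderOf b := by rw [h.q_eq hpq]; exact Nat.dvd_lcm_left _ _
  have hdec := fun {x} => h.decomp hpq (x := x)
  have hδ := h.delta_mem
  have hcM := h.card_M hpq hQ
  have hq := h.q_eq hpq
  have hqpos := orderOf_pos b
  have hsa := h.sqel_add hQ
  set n := orderOf (Abelianization.of a) with hn
  refine cyclic_of_cover_mul (commutator G) h.st.comm a _
    (fun x hx => Subgroup.Normal.conj_mem inferInstance _ hx _) h.st.c_mem h.st.min (sqel a b)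
    sqel_zero (sqel_succ h.st) ?_
  intro l hl
  rcases Nat.even_or_odd n with hne | hno
  · left
    intro x hx
    obtain ⟨i, j, rfl⟩ := hdec hx
    have hq' : orderOf b = n := by
      rw [hq]
      exact Nat.lcm_eq_right hne.two_dvd
    refine ⟨i + Q * (j * (orderOf a - 1)), 1, one_mem _, ?_⟩
    rw [hsa, hq', one_pow, mul_one]
    congr 1
    rw [← pow_mul, inv_pow, eq_inv_iff_mul_eq_one, ← pow_add]
    have hp := orderOf_pos a
    have : n * j + n * (j * (orderOf a - 1)) = orderOf a * (n * j) := by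
      obtain ⟨p', hp'⟩ : ∃ p', orderOf a = p' + 1 := ⟨orderOf a - 1, by omega⟩
      rw [hp', Nat.add_sub_cancel]; ring
    rw [this, pow_mul, pow_orderOf_eq_one, one_pow]
  · have hq' : orderOf b = 2 * n := by
      rw [hq]
      exact Nat.Coprime.lcm_eq_mul (Nat.coprime_two_left.mpr hno)
    have hQn : Q = n := by omega
    rcases hl.eq_two_or_odd' with rfl | hlo
    · right
      refine ⟨_, hδ, ?_⟩
      intro x hx
      have hidx : ((Subgroup.zpowers (a ^ n)).subgroupOf (commutator G)).index = n := by
        have h1 := Subgroup.card_mul_index ((Subgroup.zpowers (a ^ n)).subgroupOf (commutator G))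
        have h2 : Nat.card ((Subgroup.zpowers (a ^ n)).subgroupOf (commutator G)) =
            orderOf (a ^ n) := by
          rw [← Nat.card_zpowers]
          exact Nat.card_congr (Subgroup.subgroupOfEquivOfLe
            ((Subgroup.zpowers_le).mpr hδ)).toEquiv
        rw [h2, hcM, hQn] at h1
        exact Nat.eq_of_mul_eq_mul_left (orderOf_pos _) h1
      have hnorm : ((Subgroup.zpowers (a ^ n)).subgroupOf (commutator G)).Normal := by
        constructor
        rintro z hz g
        have : g * z * g⁻¹ = z := by
          apply Subtype.ext
          change (g : G) * z * (g : G)⁻¹ = z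
          rw [h.st.comm _ g.2 _ z.2, mul_inv_cancel_right]
        rwa [this]
      have h3 := Subgroup.pow_index_mem
        ((Subgroup.zpowers (a ^ n)).subgroupOf (commutator G)) ⟨x, hx⟩
      rw [hidx] at h3
      obtain ⟨j, hj⟩ : x ^ n ∈ Subgroup.zpowers (a ^ n) := h3
      have hj' : (a ^ n) ^ j = x ^ n := hj
      obtain ⟨r, hr⟩ := hno
      refine ⟨-j, x ^ (r + 1), pow_mem hx _, ?_⟩
      rw [zpow_neg, hj', ← pow_mul, eq_inv_mul_iff_mul_eq, ← pow_succ]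
      congr 1; omega
    · left
      intro x hx
      obtain ⟨i, j, rfl⟩ := hdec hx
      obtain ⟨r, hr⟩ := hlo
      refine ⟨i + Q * (j * r), (a ^ n) ^ j, pow_mem hδ _, ?_⟩
      rw [hsa, hq', mul_assoc]
      congr 1
      rw [inv_pow, eq_inv_mul_iff_mul_eq, ← pow_mul, ← pow_mul, ← pow_add, hr]
      congr 1; ring

end str3

section str4
variable {G : Type*} [Group G] {a b t : G}

theorem twist_aux {Q : Type*} [Group Q] {A C : Q} {k : ℕ} (h1 : A * C * A⁻¹ = C ^ k)
    (h2 : A⁻¹ * ((A ^ 2)⁻¹ * C⁻¹ * (A ^ 2)⁻¹⁻¹) * A⁻¹⁻¹ =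
      ((A ^ 2)⁻¹ * C⁻¹ * (A ^ 2)⁻¹⁻¹) ^ k) : C ^ (k ^ 2) = C := by
  rw [conj_pow] at h2
  have h3 : C⁻¹ = A * (C⁻¹ ^ k) * A⁻¹ := by
    calc C⁻¹ = A * (A ^ 2 * (A⁻¹ * ((A ^ 2)⁻¹ * C⁻¹ * (A ^ 2)⁻¹⁻¹) * A⁻¹⁻¹) * (A ^ 2)⁻¹) * A⁻¹ := by
          simp only [pow_two]; group
      _ = A * (A ^ 2 * ((A ^ 2)⁻¹ * C⁻¹ ^ k * (A ^ 2)⁻¹⁻¹) * (A ^ 2)⁻¹) * A⁻¹ := by rw [h2]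
      _ = _ := by simp [mul_assoc]
  rw [← conj_pow, ← conj_inv, h1, inv_pow, inv_inj, ← pow_mul, ← pow_two] at h3
  exact h3.symm

theorem graph_hom {x y x' y' : G} (hgen : Subgroup.closure ({x, y} : Set G) = ⊤)
    (hker : ∀ h : G, (1, h) ∈ Subgroup.closure ({(x, x'), (y, y')} : Set (G × G)) → h = 1) :
    ∃ f : G →* G, f x = x' ∧ f y = y' := by
  set Γ := Subgroup.closure ({(x, x'), (y, y')} : Set (G × G)) with hΓ
  have hx : (x, x') ∈ Γ := Subgroup.subset_closure (by simp)
  have hy : (y, y') ∈ Γ := Subgroup.subset_closure (by simp)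
  let π : Γ →* G := (MonoidHom.fst G G).comp Γ.subtype
  have hinj : Function.Injective π := by
    rw [injective_iff_map_eq_one]
    rintro ⟨⟨g, h⟩, hz⟩ h1
    have h1' : g = 1 := h1
    subst h1'
    have := hker h hz
    subst this
    rfl
  have hsurj : Function.Surjective π := by
    rw [← MonoidHom.range_eq_top, eq_top_iff, ← hgen, Subgroup.closure_le]
    rintro u (rfl | rfl)
    · exact ⟨⟨_, hx⟩, rfl⟩
    · exact ⟨⟨_, hy⟩, rfl⟩
  let e := MulEquiv.ofBijective π ⟨hinj, hsurj⟩
  refine ⟨((MonoidHom.snd G G).comp Γ.subtype).comp e.symm.toMonoidHom, ?_, ?_⟩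
  · have : e.symm x = ⟨_, hx⟩ := by rw [MulEquiv.symm_apply_eq]; rfl
    change (MonoidHom.snd G G) (Γ.subtype (e.symm x)) = x'
    rw [this]; rfl
  · have : e.symm y = ⟨_, hy⟩ := by rw [MulEquiv.symm_apply_eq]; rfl
    change (MonoidHom.snd G G) (Γ.subtype (e.symm y)) = y'
    rw [this]; rfl

theorem graph_regular [Finite G] (h : St a t) {c : G} (hceq : c = t * a * t * a⁻¹)
    (hM : commutator G ≤ Subgroup.zpowers c) (ht : ∀ j : ℤ, t * a ^ j ∉ commutator G)
    (k : ℕ) (hk : a * c * a⁻¹ = c ^ k) (hk2 : c ^ (k ^ 2) = c) :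
    ∃ f : G →* G, f a = a⁻¹ ∧ f t = t := by
  have hcM : c ∈ commutator G := hceq ▸ h.c_mem
  have hconj : ∀ i : ℤ, a * c ^ i * a⁻¹ = c ^ (k * i : ℤ) := by
    intro i
    rw [← conj_zpow, hk, ← zpow_natCast, zpow_mul]
  have La : ∀ i : ℤ, a * c ^ i = c ^ (k * i : ℤ) * a := by
    intro i
    rw [← hconj]; group
  have hkk : ∀ i : ℤ, c ^ (k * (k * i) : ℤ) = c ^ i := by
    intro i
    rw [← mul_assoc, zpow_mul, ← pow_two]
    congr 1
    rw [← Nat.cast_pow, zpow_natCast, hk2]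
  have La' : ∀ i : ℤ, a⁻¹ * c ^ i = c ^ (k * i : ℤ) * a⁻¹ := by
    intro i
    rw [inv_mul_eq_iff_eq_mul, ← mul_assoc, La, hkk]; group
  have Lt : ∀ i : ℤ, t * c ^ i = c ^ (-i) * t := by
    intro i
    have := h.inv (c ^ i) (zpow_mem hcM i)
    rw [zpow_neg, ← this, mul_assoc, h.tt, mul_one]
  have Lat : a * t = c ^ (-1 : ℤ) * t * a := by
    rw [zpow_neg, zpow_one, hceq]
    simp [mul_assoc, h.tinv, h.ttx]
  have Lat' : a⁻¹ * t = c ^ (k : ℤ) * t * a⁻¹ := by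
    have h1 : a⁻¹ * c ^ (-1 : ℤ) * t = t * a⁻¹ := by
      calc _ = a⁻¹ * (c ^ (-1 : ℤ) * t * a) * a⁻¹ := by group
        _ = _ := by rw [← Lat]; group
    rw [La', mul_assoc] at h1
    rw [mul_assoc (c ^ (k : ℤ)), ← h1, ← mul_assoc, ← zpow_add]
    simp
  have hcc : ∀ i j : ℤ, ∀ z : G, c ^ i * (c ^ j * z) = c ^ (i + j) * z := by
    intro i j z; rw [← mul_assoc, zpow_add]
  have P : ∀ z ∈ Subgroup.closure ({(a, a⁻¹), (t, t)} : Set (G × G)), ∃ i j : ℤ,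
      z = (c ^ i * a ^ j, c ^ (-(k * i) : ℤ) * a ^ (-j)) ∨
      z = (c ^ i * (t * a ^ j), c ^ (-(k * i) : ℤ) * (t * a ^ (-j))) := by
    intro z hz
    have ea : ∀ j : ℤ, a * a ^ j = a ^ (j + 1) := by
      intro j; rw [add_comm, zpow_one_add]
    have ea' : ∀ j : ℤ, a⁻¹ * a ^ j = a ^ (j - 1) := by
      intro j; rw [sub_eq_neg_add, zpow_add, zpow_neg_one]
    have tcase : ∀ y : G × G, (∃ i j : ℤ,
        y = (c ^ i * a ^ j, c ^ (-(k * i) : ℤ) * a ^ (-j)) ∨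
        y = (c ^ i * (t * a ^ j), c ^ (-(k * i) : ℤ) * (t * a ^ (-j)))) → ∃ i j : ℤ,
        (t, t) * y = (c ^ i * a ^ j, c ^ (-(k * i) : ℤ) * a ^ (-j)) ∨
        (t, t) * y = (c ^ i * (t * a ^ j), c ^ (-(k * i) : ℤ) * (t * a ^ (-j))) := by
      rintro _ ⟨i, j, rfl | rfl⟩
      · refine ⟨-i, j, Or.inr (Prod.ext ?_ ?_)⟩
        · change t * (c ^ i * a ^ j) = _
          rw [← mul_assoc, Lt, mul_assoc]
        · change t * (c ^ (-(k * i) : ℤ) * a ^ (-j)) = _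
          rw [← mul_assoc, Lt, mul_assoc, mul_neg]
      · refine ⟨-i, j, Or.inl (Prod.ext ?_ ?_)⟩
        · change t * (c ^ i * (t * a ^ j)) = _
          rw [← mul_assoc, Lt, mul_assoc, h.ttx]
        · change t * (c ^ (-(k * i) : ℤ) * (t * a ^ (-j))) = _
          rw [← mul_assoc, Lt, mul_assoc, mul_neg, h.ttx]
    induction hz using Subgroup.closure_induction_left with
    | one => exact ⟨0, 0, Or.inl (Prod.ext (by simp) (by simp))⟩
    | mul_left x hx y hy ih =>
      rcases hx with rfl | rfl
      · obtain ⟨i, j, rfl | rfl⟩ := ih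
        · refine ⟨k * i, j + 1, Or.inl (Prod.ext ?_ ?_)⟩
          · change a * (c ^ i * a ^ j) = _
            rw [← mul_assoc, La, mul_assoc, ea]
          · change a⁻¹ * (c ^ (-(k * i) : ℤ) * a ^ (-j)) = _
            rw [← mul_assoc, La', mul_assoc, ea', mul_neg, neg_add']
        · refine ⟨k * i + -1, j + 1, Or.inr (Prod.ext ?_ ?_)⟩
          · change a * (c ^ i * (t * a ^ j)) = _
            rw [← mul_assoc, La, mul_assoc, ← mul_assoc a, Lat, mul_assoc, mul_assoc, ea, hcc]
          · change a⁻¹ * (c ^ (-(k * i) : ℤ) * (t * a ^ (-j))) = _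
            rw [← mul_assoc, La', mul_assoc, ← mul_assoc a⁻¹, Lat', mul_assoc, mul_assoc, ea', hcc,
              neg_add']
            congr 2; ring
      · exact tcase y ih
    | inv_mul_cancel x hx y hy ih =>
      rcases hx with rfl | rfl
      · obtain ⟨i, j, rfl | rfl⟩ := ih
        · refine ⟨k * i, j - 1, Or.inl (Prod.ext ?_ ?_)⟩
          · change a⁻¹ * (c ^ i * a ^ j) = _
            rw [← mul_assoc, La', mul_assoc, ea']
          · change a⁻¹⁻¹ * (c ^ (-(k * i) : ℤ) * a ^ (-j)) = _
            rw [inv_inv, ← mul_assoc, La, mul_assoc, ea, mul_neg]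
            change _ = c ^ (-(k * (k * i)) : ℤ) * a ^ (-(j - 1))
            rw [show (-(j - 1) : ℤ) = -j + 1 by ring]
        · refine ⟨k * i + k, j - 1, Or.inr (Prod.ext ?_ ?_)⟩
          · change a⁻¹ * (c ^ i * (t * a ^ j)) = _
            rw [← mul_assoc, La', mul_assoc, ← mul_assoc a⁻¹, Lat', mul_assoc, mul_assoc, ea', hcc]
          · change a⁻¹⁻¹ * (c ^ (-(k * i) : ℤ) * (t * a ^ (-j))) = _
            rw [inv_inv, ← mul_assoc, La, mul_assoc, ← mul_assoc a, Lat, mul_assoc, mul_assoc, ea,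
              hcc]
            have e1 : (-(k * (k * i + k)) : ℤ) = k * (k * -1) + k * -(k * i) := by ring
            have e2 : (-(j - 1) : ℤ) = -j + 1 := by ring
            change _ = c ^ (-(k * (k * i + k)) : ℤ) * (t * a ^ (-(j - 1)))
            have e3 : c ^ (-(k * (k * i + k)) : ℤ) = c ^ (k * -(k * i) + -1 : ℤ) := by
              rw [e1, zpow_add, hkk, ← zpow_add, add_comm (-1 : ℤ)]
            rw [e3, e2]
      · have : ((t, t) : G × G)⁻¹ = (t, t) := Prod.ext h.tinv h.tinv
        rw [this]
        exact tcase y ih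
  apply graph_hom h.gen
  intro g hg
  obtain ⟨i, j, hz | hz⟩ := P _ hg
  · obtain ⟨h1, h2⟩ := Prod.ext_iff.mp hz
    simp only at h1 h2
    have h3 : c ^ i = a ^ (-j) := by
      rw [zpow_neg]; exact eq_inv_of_mul_eq_one_left h1.symm
    have h4 := hconj i
    have h5 : a * c ^ i * a⁻¹ = c ^ i := by rw [h3]; group
    rw [h2, zpow_neg, ← h4, h5, ← h3]; group
  · exfalso
    have h1 : (1 : G) = c ^ i * (t * a ^ j) := congrArg Prod.fst hz
    apply ht j
    rw [← inv_eq_of_mul_eq_one_right h1.symm]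
    exact inv_mem (zpow_mem hcM i)

/-- The main structural result: the type of a minimal tight chiral pair. -/
theorem MinCh.type [Finite G] (h : MinCh a b) (hpq : orderOf b ≤ orderOf a) :
    ∃ m : ℕ, (∃ α, m.Prime ∧ Odd m ∧ 2 ≤ α ∧ orderOf a = m ^ α ∧ orderOf b = 2 * m) ∨
      (∃ β, 5 ≤ β ∧ orderOf a = 2 ^ β ∧ orderOf b = 8) ∨
      (∃ α, 4 ≤ α ∧ orderOf a = 2 ^ (α + 1) ∧ orderOf b = 2 ^ α) := by
  obtain ⟨Q, hQ⟩ : 2 ∣ orderOf b := by rw [h.q_eq hpq]; exact Nat.dvd_lcm_left _ _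
  have hs := h.st
  have hδ := h.delta_mem
  have hcM := h.card_M hpq hQ
  have hq := h.q_eq hpq
  have hp := p_eq (a := a)
  have hcyc := h.cyclic hpq
  have htA := fun j => tA_notin hs (h.AM hpq) j
  have hbq : orderOf b ∣ orderOf b := dvd_rfl
  have hsucc := sqel_succ hs
  obtain ⟨m, N, hm, hN, hNc, hNa, hNM, hNmin⟩ := h.prime hpq
  have hcmem := hs.c_mem
  have hAM : ∀ x ∈ Subgroup.zpowers a, x ∈ commutator G →
      x ∈ Subgroup.zpowers (a ^ orderOf (Abelianization.of a)) := by
    rintro _ ⟨j, rfl⟩ hx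
    obtain ⟨r, hr⟩ := (pow_mem_iff j).mp hx
    refine ⟨r, ?_⟩
    change (a ^ orderOf (Abelianization.of a)) ^ r = a ^ j
    rw [hr, zpow_mul, zpow_natCast]
  set n := orderOf (Abelianization.of a) with hn
  set c := a * b * a * (a * b) * a⁻¹ with hc
  set t := a * b with ht
  have hMc : commutator G = Subgroup.zpowers c :=
    le_antisymm hcyc ((Subgroup.zpowers_le).mpr hcmem)
  have hconjM : ∀ x ∈ commutator G, a * x * a⁻¹ ∈ commutator G :=
    fun x hx => Subgroup.Normal.conj_mem inferInstance _ hx _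
  obtain ⟨k, hk1, hk⟩ : ∃ k : ℕ, 1 ≤ k ∧ a * c * a⁻¹ = c ^ k := by
    obtain ⟨k, hk⟩ := mem_powers_iff_mem_zpowers.mpr (hcyc (hconjM c hcmem))
    have hk' : c ^ k = a * c * a⁻¹ := hk
    refine ⟨k + orderOf c, by have := orderOf_pos c; omega, ?_⟩
    rw [pow_add, pow_orderOf_eq_one, mul_one, hk']
  have hyk : ∀ x ∈ commutator G, a * x * a⁻¹ = x ^ k := by
    intro x hx
    obtain ⟨i, hi⟩ := hcyc hx
    have hi' : c ^ i = x := hi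
    rw [← hi', ← conj_zpow, hk, ← zpow_natCast, ← zpow_natCast, zpow_comm]
  have hμ : orderOf c = orderOf (a ^ n) * Q := by rw [← hcM, hMc, Nat.card_zpowers]
  have hQ0 : 0 < Q := by have := orderOf_pos b; omega
  refine ⟨m, nt_main (m := m) (o := orderOf (a ^ n)) (Q := Q) (n := n) (μ := orderOf c) (k := k)
    hm hμ hQ0 hQ (by rw [← hq, hQ]) hp hk1 ?_ ?_ ?_ ?_ ?_ ?_ ?_⟩
  · -- o ∣ k - 1
    have h1 := hyk _ hδ
    have h2 : a * a ^ n * a⁻¹ = a ^ n := by rw [← pow_succ', pow_succ, mul_inv_cancel_right]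
    rw [h2] at h1
    apply orderOf_dvd_of_pow_eq_one
    have h3 : (a ^ n) ^ (k - 1) * (a ^ n) = a ^ n := by
      rw [← pow_succ, Nat.sub_add_cancel hk1, ← h1]
    exact mul_eq_right.mp h3
  · -- m ∣ o
    have : N ≤ Subgroup.zpowers (a ^ n) := fun x hx => hAM x (hNa hx) (hNM hx)
    have := Subgroup.card_dvd_of_le this
    rwa [hNc, Nat.card_zpowers] at this
  · -- o is a power of m
    obtain ⟨e, he⟩ := m_power hm hNc hNmin (x := a ^ n) (pow_mem (Subgroup.mem_zpowers a) n)
      (fun i => hs.normal_a _ ((Subgroup.zpowers_le).mpr (pow_mem hδ i))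
        ((Subgroup.zpowers_le).mpr (pow_mem (pow_mem (Subgroup.mem_zpowers a) n) i)))
    obtain ⟨e', _, he'⟩ := (Nat.dvd_prime_pow hm).mp (orderOf_dvd_of_pow_eq_one he)
    exact ⟨e', he'⟩
  · skip
    intro hdiv
    apply h.chir
    have hk2 : c ^ (k ^ 2) = c := by
      have h1 := orderOf_dvd_iff_pow_eq_one.mp hdiv
      have h2 : 1 ≤ k ^ 2 := Nat.one_le_pow _ _ hk1
      rw [← Nat.sub_add_cancel h2, pow_succ, h1, one_mul]
    obtain ⟨f, fa, ft⟩ := graph_regular hs hc hcyc htA k hk hk2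
    refine regular_of_hom h.gen ((MulAut.conj a⁻¹).toMonoidHom.comp f) ?_ ?_
    · change a⁻¹ * f a * a⁻¹⁻¹ = a⁻¹
      rw [fa]; group
    · change a⁻¹ * f b * a⁻¹⁻¹ = b⁻¹
      have hb : b = a⁻¹ * t := by rw [ht]; group
      have : f b = a * t := by
        conv_lhs => rw [hb]
        rw [map_mul, map_inv, fa, ft, inv_inv]
      rw [this, inv_mul_cancel_left, inv_inv]
      exact hs.binv
  · -- quotient regular
    have hNne : N ≠ ⊥ := by
      intro h0
      rw [h0, Subgroup.card_bot] at hNc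
      exact hm.one_lt.ne hNc
    obtain ⟨f, fa, fb⟩ := h.quot N hNne (Or.inl hNa)
    have hTT : (t : G ⧸ N) * t = 1 := by rw [← QuotientGroup.mk_mul, hs.tt]; rfl
    have hTi : (t : G ⧸ N)⁻¹ = t := inv_eq_of_mul_eq_one_left hTT
    have hb : b = a⁻¹ * t := by rw [ht]; group
    have fb' : f b = (t : G ⧸ N) * a := by
      rw [fb]
      conv_lhs => rw [hb]
      rw [QuotientGroup.mk_mul, QuotientGroup.mk_inv, mul_inv_rev, inv_inv, hTi]
    have ft : f t = (a : G ⧸ N)⁻¹ * (t * a) := by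
      rw [ht, map_mul, fa, ← ht, fb']
    have hC : (c : G ⧸ N) = t * a * t * (a : G ⧸ N)⁻¹ := rfl
    have fc : f c = ((a : G ⧸ N) ^ 2)⁻¹ * (c : G ⧸ N)⁻¹ * ((a : G ⧸ N) ^ 2)⁻¹⁻¹ := by
      have : f c = f t * f a * f t * (f a)⁻¹ := by
        rw [← map_inv, ← map_mul, ← map_mul, ← map_mul]
      rw [this, fa, ft, hC]
      simp only [mul_inv_rev, inv_inv, hTi, pow_two, mul_assoc, mul_inv_cancel_left,
        inv_mul_cancel_left]
    have hk' : (a : G ⧸ N) * c * (a : G ⧸ N)⁻¹ = (c : G ⧸ N) ^ k :=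
      congrArg (QuotientGroup.mk' N) hk
    have h1 : f a * f c * (f a)⁻¹ = (f c) ^ k := by
      rw [← map_inv, ← map_mul, ← map_mul, hk, map_pow]
    rw [fa, fc] at h1
    have h2 := twist_aux hk' h1
    have h3 : (c : G ⧸ N) ^ (k ^ 2 - 1) = 1 := by
      have h4 : 1 ≤ k ^ 2 := Nat.one_le_pow _ _ hk1
      rw [← Nat.sub_add_cancel h4, pow_succ] at h2
      exact mul_eq_right.mp h2
    have h5 : c ^ (k ^ 2 - 1) ∈ N := by
      rw [← QuotientGroup.eq_one_iff]; exact h3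
    apply orderOf_dvd_of_pow_eq_one
    have h6 := pow_card_eq_one' (x := (⟨_, h5⟩ : N))
    rw [hNc] at h6
    have h7 : (c ^ (k ^ 2 - 1)) ^ m = 1 := congrArg Subtype.val h6
    rw [mul_comm, pow_mul, h7]
  · -- c5
    intro i hi
    have hsq : ∀ i, sqel a b i = c ^ gs (k ^ 2) i := by
      intro i
      induction i with
      | zero => rw [gs_zero, pow_zero, sqel_zero]
      | succ i ih =>
        rw [hsucc, ih, gs_succ, hyk _ (pow_mem hcmem _),
          hyk _ (pow_mem (pow_mem hcmem _) _), pow_add, pow_one, ← pow_mul, ← pow_mul]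
        congr 2; ring
    have h1 : a * sqel a b i * a⁻¹ = sqel a b i := by
      rw [hsq, hyk _ (pow_mem hcmem _), ← pow_mul]
      have h2 := orderOf_dvd_iff_pow_eq_one.mp hi
      have h3 : gs (k ^ 2) i * k = (k - 1) * gs (k ^ 2) i + gs (k ^ 2) i := by
        obtain ⟨k', rfl⟩ := Nat.exists_eq_add_of_le hk1
        rw [Nat.add_sub_cancel_left]; ring
      rw [h3, pow_add, h2, one_mul]
    have h2 : b⁻¹ ^ (2 * i) = 1 := by
      apply h.b_central hpq (pow_mem (inv_mem (Subgroup.mem_zpowers b)) _)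
      have e : b⁻¹ ^ (2 * i) = sqel a b i * a ^ (2 * i) := by
        rw [sqel, inv_pow a, inv_mul_cancel_right]
      have h3 : a * sqel a b i = sqel a b i * a := mul_inv_eq_iff_eq_mul.mp h1
      rw [e, ← mul_assoc, h3, mul_assoc, mul_assoc, ← pow_succ, ← pow_succ']
    rw [inv_pow, inv_eq_one] at h2
    have h3 := orderOf_dvd_of_pow_eq_one h2
    rw [hQ] at h3
    exact Nat.dvd_of_mul_dvd_mul_left (by norm_num) h3
  · -- c6
    intro j hj
    have hu : ∀ j : ℕ, a ^ j * t * (a ^ j)⁻¹ * t = (c ^ gs k j)⁻¹ := by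
      intro j
      induction j with
      | zero => simp [gs_zero, hs.tt]
      | succ j ih =>
        have e1 : a ^ (j + 1) * t * (a ^ (j + 1))⁻¹ * t =
            a * (a ^ j * t * (a ^ j)⁻¹ * t) * a⁻¹ * (a * t * a⁻¹ * t) := by
          have : a ^ j * t * (a ^ j)⁻¹ = (a ^ j * t * (a ^ j)⁻¹ * t) * t := by
            rw [mul_assoc _ t t, hs.tt, mul_one]
          calc _ = a * (a ^ j * t * (a ^ j)⁻¹) * a⁻¹ * t := by rw [pow_succ']; group
            _ = _ := by rw [this]; simp only [mul_assoc, inv_mul_cancel_left, hs.ttx]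
        have e2 : a * t * a⁻¹ * t = c⁻¹ := by
          rw [hc]; simp [mul_assoc, hs.tinv]
        rw [e1, ih, e2, hyk _ (inv_mem (pow_mem hcmem _)), gs_succ, pow_add, pow_one,
          inv_pow, ← pow_mul, mul_comm k]
        exact (mul_inv_rev c _).symm
    have h1 := hu j
    rw [orderOf_dvd_iff_pow_eq_one.mp hj, inv_one] at h1
    have h2 : t * a ^ j = a ^ j * t := by
      have h3 : a ^ j * t * (a ^ j)⁻¹ = t := by
        rw [← hs.tinv]
        have := eq_inv_of_mul_eq_one_left h1
        rwa [hs.tinv] at this ⊢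
      rw [mul_inv_eq_iff_eq_mul] at h3
      exact h3.symm
    have hta : ∀ i : ℕ, t * (a ^ j) ^ i = (a ^ j) ^ i * t :=
      fun i => ((show Commute t (a ^ j) from h2).pow_right i).eq
    have haa : ∀ i : ℕ, a * (a ^ j) ^ i = (a ^ j) ^ i * a :=
      fun i => (((Commute.refl a).pow_right j).pow_right i).eq
    obtain ⟨e, he⟩ := m_power hm hNc hNmin (x := a ^ j) (pow_mem (Subgroup.mem_zpowers a) j)
      (fun i => normal_zpowers_of_central hs.gen (haa i) (hta i))
    refine ⟨e, orderOf_dvd_of_pow_eq_one ?_⟩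
    rw [pow_mul, he]

end str4

section top

/-- A finite tight chiral rotation pair in `Type`. -/
def TCP {H : Type*} [Group H] (a b : H) : Prop :=
  (∃ p q, IsRotPair a b p q) ∧ IsTight a b ∧ IsChiral a b

theorem covers_trans {G H K : Type*} [Group G] [Group H] [Group K] {a b : G} {a' b' : H}
    {a'' b'' : K} (h1 : Covers a b a' b') (h2 : Covers a' b' a'' b'') : Covers a b a'' b'' := by
  obtain ⟨f, rfl, rfl⟩ := h1
  obtain ⟨g, rfl, rfl⟩ := h2
  exact ⟨g.comp f, rfl, rfl⟩

theorem tight_of_surj {G H : Type*} [Group G] [Group H] {a b : G} (f : G →* H)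
    (hf : Function.Surjective f) (h : IsTight a b) : IsTight (f a) (f b) := by
  intro y
  obtain ⟨x, rfl⟩ := hf y
  obtain ⟨i, j, rfl⟩ := h x
  exact ⟨i, j, by simp⟩

theorem gen_of_tight {G : Type*} [Group G] {a b : G} (h : IsTight a b) :
    Subgroup.closure ({a, b} : Set G) = ⊤ := by
  rw [eq_top_iff]
  intro x _
  obtain ⟨i, j, rfl⟩ := h x
  exact mul_mem (zpow_mem (Subgroup.subset_closure (by simp)) _)
    (zpow_mem (Subgroup.subset_closure (by simp)) _)

theorem tcp_of_equiv {G H : Type*} [Group G] [Group H] {a b : G} (e : G ≃* H)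
    (h : TCP a b) : TCP (e a) (e b) := by
  obtain ⟨⟨p, q, h1, h2, h3, h4, h5, h6, h7⟩, h8, h9⟩ := h
  have ht : IsTight (e a) (e b) := tight_of_surj e.toMonoidHom e.surjective h8
  refine ⟨⟨p, q, gen_of_tight ht, ?_, ?_, h4, h5, ?_, ?_⟩, ht, ?_⟩
  · rw [MulEquiv.orderOf_eq, h2]
  · rw [MulEquiv.orderOf_eq, h3]
  · rw [← map_mul, ← map_pow, h6, map_one]
  · rw [eq_bot_iff]
    rintro x ⟨⟨i, hi⟩, ⟨j, hj⟩⟩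
    have hi' : (e a) ^ i = x := hi
    have hj' : (e b) ^ j = x := hj
    have h10 : a ^ i = b ^ j := e.injective (by rw [map_zpow, map_zpow, hi', hj'])
    have h11 : a ^ i ∈ Subgroup.zpowers a ⊓ Subgroup.zpowers b :=
      ⟨⟨i, rfl⟩, ⟨j, h10.symm⟩⟩
    rw [h7, Subgroup.mem_bot] at h11
    rw [Subgroup.mem_bot, ← hi', ← map_zpow, h11, map_one]
  · rintro ⟨φ, ha, hb⟩
    refine h9 ⟨(e.trans φ).trans e.symm, ?_, ?_⟩
    · change e.symm (φ (e a)) = _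
      rw [ha, ← map_inv, MulEquiv.symm_apply_apply]
    · change e.symm (φ (e b)) = _
      rw [hb, ← map_inv, MulEquiv.symm_apply_apply]

theorem quot_disj {G : Type*} [Group G] {a b : G} (K : Subgroup G) [K.Normal]
    (hd : Subgroup.zpowers a ⊓ Subgroup.zpowers b = ⊥)
    (hK : K ≤ Subgroup.zpowers a ∨ K ≤ Subgroup.zpowers b) :
    Subgroup.zpowers (a : G ⧸ K) ⊓ Subgroup.zpowers (b : G ⧸ K) = ⊥ := by
  rw [eq_bot_iff]
  rintro x ⟨⟨i, hi⟩, ⟨j, hj⟩⟩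
  have hi' : (a : G ⧸ K) ^ i = x := hi
  have hj' : (b : G ⧸ K) ^ j = x := hj
  have h1 : ((a ^ i : G) : G ⧸ K) = ((b ^ j : G) : G ⧸ K) := by
    rw [QuotientGroup.mk_zpow, QuotientGroup.mk_zpow, hi', hj']
  have h2 : (a ^ i)⁻¹ * b ^ j ∈ K := QuotientGroup.eq.mp h1
  have ha : a ^ i ∈ Subgroup.zpowers a := ⟨i, rfl⟩
  have hb : b ^ j ∈ Subgroup.zpowers b := ⟨j, rfl⟩
  rw [Subgroup.mem_bot]
  rcases hK with hK | hK
  · have h3 : b ^ j ∈ Subgroup.zpowers a ⊓ Subgroup.zpowers b :=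
      ⟨by simpa using mul_mem ha (hK h2), hb⟩
    rw [hd, Subgroup.mem_bot] at h3
    rw [← hj', ← QuotientGroup.mk_zpow, h3, QuotientGroup.mk_one]
  · have h3 : a ^ i ∈ Subgroup.zpowers a ⊓ Subgroup.zpowers b :=
      ⟨ha, by simpa using mul_mem hb (inv_mem (hK h2))⟩
    rw [hd, Subgroup.mem_bot] at h3
    rw [← hi', ← QuotientGroup.mk_zpow, h3, QuotientGroup.mk_one]

theorem minCh_of_minimal {H : Type} [Group H] [Finite H] {a b : H} (h : TCP a b)
    (hmin : ∀ (K : Type) [Group K] [Finite K] (a' b' : K), TCP a' b' → Covers a b a' b' →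
      Nat.card H ≤ Nat.card K) : MinCh a b := by
  have h' := h
  obtain ⟨⟨p, q, h1, h2, h3, h4, h5, h6, h7⟩, h8, h9⟩ := h
  refine ⟨h1, h6, h8, h7, h9, ?_⟩
  intro K hKn hK hKab
  have ht : IsTight (a : H ⧸ K) (b : H ⧸ K) :=
    tight_of_surj (QuotientGroup.mk' K) (QuotientGroup.mk'_surjective K) h8
  have hd := quot_disj K h7 hKab
  by_cases ha : 2 ≤ orderOf (a : H ⧸ K)
  · by_cases hb : 2 ≤ orderOf (b : H ⧸ K)
    · by_cases hc : IsChiral (a : H ⧸ K) (b : H ⧸ K)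
      · exfalso
        have h10 : TCP (a : H ⧸ K) (b : H ⧸ K) := by
          refine ⟨⟨_, _, gen_of_tight ht, rfl, rfl, ha, hb, ?_, hd⟩, ht, hc⟩
          rw [← QuotientGroup.mk_mul, ← QuotientGroup.mk_pow, h6, QuotientGroup.mk_one]
        have h11 := hmin (H ⧸ K) _ _ h10 ⟨QuotientGroup.mk' K, rfl, rfl⟩
        have h12 := Subgroup.card_eq_card_quotient_mul_card_subgroup K
        have h13 : 1 < Nat.card K := (Subgroup.one_lt_card_iff_ne_bot K).mpr hK
        have h14 : 0 < Nat.card (H ⧸ K) := Nat.card_pos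
        nlinarith
      · obtain ⟨φ, hφa, hφb⟩ := not_not.mp hc
        exact ⟨φ.toMonoidHom.comp (QuotientGroup.mk' K), hφa, hφb⟩
    · have hb1 : (b : H ⧸ K) = 1 := by
        rw [← orderOf_eq_one_iff]
        have := orderOf_pos (b : H ⧸ K)
        omega
      apply reflQ_of_comm
      apply zpowers_comm_of_gen (x := (a : H ⧸ K))
      intro y
      obtain ⟨i, j, rfl⟩ := ht y
      exact ⟨i, by simp [hb1]⟩
  · have ha1 : (a : H ⧸ K) = 1 := by
      rw [← orderOf_eq_one_iff]
      have := orderOf_pos (a : H ⧸ K)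
      omega
    apply reflQ_of_comm
    apply zpowers_comm_of_gen (x := (b : H ⧸ K))
    intro y
    obtain ⟨i, j, rfl⟩ := ht y
    exact ⟨j, by simp [ha1]⟩

theorem atomic_of_minimal {H : Type} [Group H] [Finite H] {a b : H} (h : TCP a b)
    (hmin : ∀ (K : Type) [Group K] [Finite K] (a' b' : K), TCP a' b' → Covers a b a' b' →
      Nat.card H ≤ Nat.card K) : IsAtomicPair a b (orderOf a) (orderOf b) := by
  obtain ⟨⟨p, q, h1, rfl, rfl, h4, h5, h6, h7⟩, h8, h9⟩ := id h
  have hc := card_eq h8 h7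
  refine ⟨⟨h1, rfl, rfl, h4, h5, h6, h7⟩, h8, h9, ?_, ?_⟩
  · intro K iK fK a' b' p' hlt hp ht hch hcov
    have h10 := hmin K a' b' ⟨⟨_, _, hp⟩, ht, hch⟩ hcov
    obtain ⟨_, g2, g3, _, _, _, g7⟩ := hp
    rw [hc, card_eq ht g7, g2, g3] at h10
    nlinarith
  · intro K iK fK a' b' q' hlt hp ht hch hcov
    have h10 := hmin K a' b' ⟨⟨_, _, hp⟩, ht, hch⟩ hcov
    obtain ⟨_, g2, g3, _, _, _, g7⟩ := hp
    rw [hc, card_eq ht g7, g2, g3] at h10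
    nlinarith

theorem exists_minimal {G : Type*} [Group G] [Finite G] {a b : G} (h : TCP a b) :
    ∃ (H : Type) (_ : Group H) (_ : Finite H) (a' b' : H), Covers a b a' b' ∧ TCP a' b' ∧
      ∀ (K : Type) [Group K] [Finite K] (a'' b'' : K), TCP a'' b'' → Covers a' b' a'' b'' →
      Nat.card H ≤ Nat.card K := by
  classical
  have hex : ∃ n : ℕ, ∃ (H : Type) (_ : Group H) (_ : Finite H) (a' b' : H),
      Nat.card H = n ∧ Covers a b a' b' ∧ TCP a' b' := by
    have : Finite (Shrink.{0} G) := Finite.of_equiv G (equivShrink.{0} G)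
    have e' : G ≃* Shrink.{0} G := Shrink.mulEquiv.symm
    exact ⟨_, Shrink.{0} G, inferInstance, inferInstance, e' a, e' b, rfl,
      ⟨e'.toMonoidHom, rfl, rfl⟩, tcp_of_equiv e' h⟩
  obtain ⟨H, gH, fH, a', b', hn, hcov, htcp⟩ := Nat.find_spec hex
  refine ⟨H, gH, fH, a', b', hcov, htcp, ?_⟩
  intro K _ _ a'' b'' h1 h2
  rw [hn]
  exact Nat.find_min' hex ⟨K, inferInstance, inferInstance, a'', b'', rfl,
    covers_trans hcov h2, h1⟩

end top

/-- Every tight chiral rotation pair covers an atomic chiral rotation pair of one of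
the listed types. -/
theorem tight_chiral_covers_atomic {G : Type*} [Group G] [Finite G] (a b : G) (p q : ℕ)
    (hpair : IsRotPair a b p q) (htight : IsTight a b) (hchiral : IsChiral a b) :
    ∃ (H : Type) (instH : Group H) (_ : Finite H) (a' b' : H) (r s : ℕ),
      @Covers G H _ instH a b a' b' ∧ @IsAtomicPair H instH a' b' r s ∧
      ((∃ m α : ℕ, m.Prime ∧ Odd m ∧ 2 ≤ α ∧
          ((r = 2 * m ∧ s = m ^ α) ∨ (r = m ^ α ∧ s = 2 * m))) ∨
       (∃ β : ℕ, 5 ≤ β ∧ ((r = 8 ∧ s = 2 ^ β) ∨ (r = 2 ^ β ∧ s = 8))) ∨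
       (∃ α : ℕ, 4 ≤ α ∧ ((r = 2 ^ α ∧ s = 2 ^ (α + 1)) ∨ (r = 2 ^ (α + 1) ∧ s = 2 ^ α)))) := by
  obtain ⟨H, gH, fH, a', b', hcov, htcp, hmin⟩ :=
    exists_minimal (a := a) (b := b) ⟨⟨p, q, hpair⟩, htight, hchiral⟩
  refine ⟨H, gH, fH, a', b', orderOf a', orderOf b', hcov, atomic_of_minimal htcp hmin, ?_⟩
  have hM := minCh_of_minimal htcp hmin
  rcases le_total (orderOf b') (orderOf a') with hle | hle
  · obtain ⟨m, ⟨α, h1, h2, h3, h4, h5⟩ | ⟨β, h1, h2, h3⟩ | ⟨α, h1, h2, h3⟩⟩ := hM.type hle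
    · exact Or.inl ⟨m, α, h1, h2, h3, Or.inr ⟨h4, h5⟩⟩
    · exact Or.inr (Or.inl ⟨β, h1, Or.inr ⟨h2, h3⟩⟩)
    · exact Or.inr (Or.inr ⟨α, h1, Or.inr ⟨h2, h3⟩⟩)
  · obtain ⟨m, ⟨α, h1, h2, h3, h4, h5⟩ | ⟨β, h1, h2, h3⟩ | ⟨α, h1, h2, h3⟩⟩ := hM.swap.type hle
    · exact Or.inl ⟨m, α, h1, h2, h3, Or.inl ⟨h5, h4⟩⟩
    · exact Or.inr (Or.inl ⟨β, h1, Or.inl ⟨h3, h2⟩⟩)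
    · exact Or.inr (Or.inr ⟨α, h1, Or.inl ⟨h3, h2⟩⟩)
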